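/- arXiv:1109.3893 — 7 statements merged into one kernel-verified Lean document; each statement's English description precedes it below -/
import Mathlib

section
/- If f is an optimal pseudoflow for the symmetric linear generalized flow problem (i.e. f minimizes the excess discrepancy κ_f over all pseudoflows), then the residual graph E_f contains no generalized augmenting path. -/
/-!
STATEMENT 0: If `f` is an optimal pseudoflow for the symmetric linear generalized flow
problem (i.e. it minimizes the excess discrepancy `κ_f` over all pseudoflows), then the
residual graph `E_f` contains no generalized augmenting path.
-/

open Finset

/-- A symmetric linear generalized flow network. -/
structure LinNet (V : Type*) [Fintype V] [DecidableEq V] where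
  /-- the arc set -/
  E : Finset (V × V)
  /-- upper capacities -/
  u : V × V → ℝ
  /-- gain factors -/
  γ : V × V → ℝ
  /-- node demands -/
  b : V → ℝ
  /-- penalty factors -/
  M : V → ℝ
  u_nonneg : ∀ a ∈ E, 0 ≤ u a
  γ_pos : ∀ a ∈ E, 0 < γ a
  M_pos : ∀ i, 0 < M i

namespace LinNet

variable {V : Type*} [Fintype V] [DecidableEq V]

/-- A pseudoflow: `0 ≤ f ≤ u` on every arc. -/
def IsPseudoflow (N : LinNet V) (f : V × V → ℝ) : Prop :=
  ∀ a ∈ N.E, 0 ≤ f a ∧ f a ≤ N.u a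

/-- The excess `e_i = Σ_{ji∈E} γ_{ji} f_{ji} − Σ_{ij∈E} f_{ij} − b_i`. -/
noncomputable def excess (N : LinNet V) (f : V × V → ℝ) (i : V) : ℝ :=
  ∑ a ∈ N.E.filter (fun a => a.2 = i), N.γ a * f a
    - ∑ a ∈ N.E.filter (fun a => a.1 = i), f a - N.b i

/-- The excess discrepancy `κ_f = Σ_i M_i · max{−e_i, 0}`. -/
noncomputable def kappa (N : LinNet V) (f : V × V → ℝ) : ℝ :=
  ∑ i, N.M i * max (-(N.excess f i)) 0

/-- A residual arc is an original arc together with a direction: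
`true` = forward copy, `false` = backward copy. -/
def resTail (e : (V × V) × Bool) : V := if e.2 then e.1.1 else e.1.2

def resHead (e : (V × V) × Bool) : V := if e.2 then e.1.2 else e.1.1

/-- Membership in the residual graph `E_f`. -/
def IsResArc (N : LinNet V) (f : V × V → ℝ) (e : (V × V) × Bool) : Prop :=
  e.1 ∈ N.E ∧ (if e.2 then f e.1 < N.u e.1 else 0 < f e.1)

/-- The gain of a residual arc: `γ_e` forward, `1/γ_e` backward. -/
noncomputable def resGain (N : LinNet V) (e : (V × V) × Bool) : ℝ :=
  if e.2 then N.γ e.1 else (N.γ e.1)⁻¹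

/-- `IsResWalk N f s t L`: `L` is a walk in the residual graph `E_f` from `s` to `t`. -/
def IsResWalk (N : LinNet V) (f : V × V → ℝ) : V → V → List ((V × V) × Bool) → Prop
  | s, t, [] => s = t
  | s, t, e :: L => N.IsResArc f e ∧ resTail e = s ∧ N.IsResWalk f (resHead e) t L

/-- The gain `γ(P)` of a walk: the product of the gains of its arcs. -/
noncomputable def gain (N : LinNet V) (L : List ((V × V) × Bool)) : ℝ :=
  (L.map N.resGain).prod

/-- A path in `E_f` from `s` to `t`: a walk with pairwise distinct vertices. -/
def IsResPath (N : LinNet V) (f : V × V → ℝ) (s t : V) (L : List ((V × V) × Bool)) : Prop :=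
  N.IsResWalk f s t L ∧ (s :: L.map resHead).Nodup

/-- A cycle through `i` in `E_f`: a nonempty closed walk whose vertices are distinct. -/
def IsResCycle (N : LinNet V) (f : V × V → ℝ) (i : V) (L : List ((V × V) × Bool)) : Prop :=
  L ≠ [] ∧ N.IsResWalk f i i L ∧ (L.map resHead).Nodup

/-- `E_f` contains a generalized augmenting path (GAP):
(a) a flow-generating cycle (gain `> 1`) together with a path to a node of negative excess;
(b) a path from a node of positive excess to a node of negative excess;
(c) a path `P` from `s` with `e_s ≤ 0` to `t` with `e_t < 0` such that `γ(P) > M_s/M_t`. -/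
def HasGAP (N : LinNet V) (f : V × V → ℝ) : Prop :=
  (∃ i C t P, N.IsResCycle f i C ∧ 1 < N.gain C ∧
      N.IsResPath f i t P ∧ N.excess f t < 0) ∨
  (∃ s t P, N.IsResPath f s t P ∧ 0 < N.excess f s ∧ N.excess f t < 0) ∨
  (∃ s t P, N.IsResPath f s t P ∧ N.excess f s ≤ 0 ∧ N.excess f t < 0 ∧
      N.M s / N.M t < N.gain P)

open Filter Topology

/-- The net inflow created at each node by changing the flow along `d`. -/
noncomputable def netInflow (N : LinNet V) : (V × V → ℝ) →ₗ[ℝ] (V → ℝ) where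
  toFun d i := ∑ a ∈ N.E.filter (fun a => a.2 = i), N.γ a * d a
    - ∑ a ∈ N.E.filter (fun a => a.1 = i), d a
  map_add' d d' := by
    ext i
    simp only [Pi.add_apply, mul_add, sum_add_distrib]
    ring
  map_smul' c d := by
    ext i
    simp only [Pi.smul_apply, smul_eq_mul, RingHom.id_apply, mul_sub, mul_sum]
    simp only [mul_left_comm]

theorem netInflow_apply (N : LinNet V) (d : V × V → ℝ) (i : V) :
    N.netInflow d i = ∑ a ∈ N.E.filter (fun a => a.2 = i), N.γ a * d a
      - ∑ a ∈ N.E.filter (fun a => a.1 = i), d a := rfl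

theorem excess_add_smul (N : LinNet V) (f d : V × V → ℝ) (ε : ℝ) (i : V) :
    N.excess (f + ε • d) i = N.excess f i + ε * N.netInflow d i := by
  have h (g : V × V → ℝ) : N.excess g i = N.netInflow g i - N.b i := rfl
  rw [h, h, map_add, map_smul, Pi.add_apply, Pi.smul_apply, smul_eq_mul]
  ring

theorem netInflow_single (N : LinNet V) {a : V × V} (ha : a ∈ N.E) (x : ℝ) :
    N.netInflow (Pi.single a x) = Pi.single a.2 (N.γ a * x) - Pi.single a.1 x := by
  ext i
  simp [netInflow_apply, Pi.single_apply, ha, eq_comm]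

/-- `d` is a direction in which `f` can be changed without violating any capacity. -/
def IsFeasibleDir (N : LinNet V) (f d : V × V → ℝ) : Prop :=
  ∀ a ∈ N.E, (f a = 0 → 0 ≤ d a) ∧ (f a = N.u a → d a ≤ 0)

theorem IsFeasibleDir.add_smul {N : LinNet V} {f d d' : V × V → ℝ}
    (hd : N.IsFeasibleDir f d) (hd' : N.IsFeasibleDir f d') {c : ℝ} (hc : 0 ≤ c) :
    N.IsFeasibleDir f (d + c • d') := fun a ha =>
  ⟨fun h => add_nonneg ((hd a ha).1 h) (mul_nonneg hc ((hd' a ha).1 h)),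
    fun h => add_nonpos ((hd a ha).2 h) (mul_nonpos_of_nonneg_of_nonpos hc ((hd' a ha).2 h))⟩

theorem eventually_add_mul_lt {x y c : ℝ} (h : x < y) : ∀ᶠ ε in 𝓝[>] (0 : ℝ), x + ε * c < y := by
  have ht : Tendsto (fun ε : ℝ => x + ε * c) (𝓝[>] 0) (𝓝 x) := by
    have : Continuous fun ε : ℝ => x + ε * c := by fun_prop
    simpa using (this.tendsto 0).mono_left nhdsWithin_le_nhds
  exact ht.eventually_lt_const h

theorem eventually_lt_add_mul {x y c : ℝ} (h : y < x) : ∀ᶠ ε in 𝓝[>] (0 : ℝ), y < x + ε * c := by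
  filter_upwards [eventually_add_mul_lt (c := -c) (neg_lt_neg h)] with ε hε
  linarith

theorem IsFeasibleDir.eventually_isPseudoflow {N : LinNet V} {f d : V × V → ℝ}
    (hd : N.IsFeasibleDir f d) (hf : N.IsPseudoflow f) :
    ∀ᶠ ε in 𝓝[>] (0 : ℝ), N.IsPseudoflow (f + ε • d) := by
  refine (eventually_all_finset N.E).2 fun a ha => ?_
  obtain ⟨h0, hu⟩ := hf a ha
  refine Eventually.and ?_ ?_
  · rcases h0.eq_or_lt with h | h
    · filter_upwards [self_mem_nhdsWithin] with ε hε
      exact add_nonneg h0 (mul_nonneg (le_of_lt hε) ((hd a ha).1 h.symm))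
    · exact (eventually_lt_add_mul h).mono fun _ => le_of_lt
  · rcases hu.eq_or_lt with h | h
    · filter_upwards [self_mem_nhdsWithin] with ε hε
      exact add_le_of_le_of_nonpos hu
        (mul_nonpos_of_nonneg_of_nonpos (le_of_lt hε) ((hd a ha).2 h))
    · exact (eventually_add_mul_lt h).mono fun _ => le_of_lt

theorem resGain_pos {N : LinNet V} {e : (V × V) × Bool} (he : e.1 ∈ N.E) : 0 < N.resGain e := by
  have := N.γ_pos _ he
  unfold resGain
  split_ifs <;> positivity

theorem IsResWalk.gain_pos {N : LinNet V} {f : V × V → ℝ} {L : List ((V × V) × Bool)} {s t : V}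
    (h : N.IsResWalk f s t L) : 0 < N.gain L := by
  induction L generalizing s with
  | nil => simp [gain]
  | cons e L ih =>
    simpa [gain] using mul_pos (resGain_pos h.1.1) (ih h.2.2)

/-- A residual arc can carry one unit of flow out of its tail. -/
theorem IsResArc.exists_dir {N : LinNet V} {f : V × V → ℝ} {e : (V × V) × Bool}
    (h : N.IsResArc f e) :
    ∃ d, N.IsFeasibleDir f d ∧
      N.netInflow d = Pi.single (resHead e) (N.resGain e) - Pi.single (resTail e) 1 := by
  obtain ⟨a, dir⟩ := e
  obtain ⟨ha, h⟩ := h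
  have hγ := N.γ_pos a ha
  cases dir
  · simp only [Bool.false_eq_true, if_false] at h
    refine ⟨Pi.single a (-(N.γ a)⁻¹), fun b _ => ?_, ?_⟩
    · by_cases hb : b = a
      · subst hb
        simp [h.ne', hγ.le]
      · simp [hb]
    · rw [netInflow_single N ha, mul_neg, mul_inv_cancel₀ hγ.ne']
      simp only [resHead, resTail, resGain, Bool.false_eq_true, if_false, Pi.single_neg]
      abel
  · simp only [if_true] at h
    refine ⟨Pi.single a 1, fun b _ => ?_, ?_⟩
    · by_cases hb : b = a
      · subst hb
        simp [h.ne]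
      · simp [hb]
    · rw [netInflow_single N ha]
      simp [resHead, resTail, resGain]

/-- A residual walk can carry one unit of flow out of its first node, delivering its gain. -/
theorem IsResWalk.exists_dir {N : LinNet V} {f : V × V → ℝ} {L : List ((V × V) × Bool)} {s t : V}
    (h : N.IsResWalk f s t L) :
    ∃ d, N.IsFeasibleDir f d ∧
      N.netInflow d = Pi.single t (N.gain L) - Pi.single s 1 := by
  induction L generalizing s with
  | nil =>
    obtain rfl : s = t := h
    exact ⟨0, fun a _ => by simp, by simp [gain]⟩
  | cons e L ih =>
    obtain ⟨he, rfl, hL⟩ := h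
    obtain ⟨d, hd, hd_in⟩ := he.exists_dir
    obtain ⟨d', hd', hd'_in⟩ := ih hL
    refine ⟨d + N.resGain e • d', hd.add_smul hd' (resGain_pos he.1).le, ?_⟩
    rw [map_add, map_smul, hd_in, hd'_in, smul_sub, ← Pi.single_smul, ← Pi.single_smul]
    simp [gain]

/-- A pseudoflow admitting a feasible direction along which the discrepancy decreases at rate at
least `-∑ i, N.M i * w i > 0` is not optimal. -/
theorem IsFeasibleDir.exists_kappa_lt {N : LinNet V} {f d : V × V → ℝ} {w : V → ℝ}
    (hd : N.IsFeasibleDir f d) (hf : N.IsPseudoflow f)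
    (hw : ∀ i, (N.excess f i < 0 ∨ N.netInflow d i ≤ 0) ∧ w i = -N.netInflow d i ∨
      0 < N.excess f i ∧ w i = 0)
    (hsum : ∑ i, N.M i * w i < 0) :
    ∃ g, N.IsPseudoflow g ∧ N.kappa g < N.kappa f := by
  have hmax : ∀ᶠ ε in 𝓝[>] (0 : ℝ), ∀ i,
      max (-(N.excess (f + ε • d) i)) 0 ≤ max (-(N.excess f i)) 0 + ε * w i := by
    refine eventually_all.2 fun i => ?_
    simp only [excess_add_smul]
    rcases hw i with ⟨he | hc, hwi⟩ | ⟨he, hwi⟩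
    · filter_upwards [eventually_add_mul_lt (c := N.netInflow d i) he] with ε hε
      rw [max_eq_left (by linarith), max_eq_left (by linarith), hwi]
      linarith
    · filter_upwards [self_mem_nhdsWithin] with ε hε
      have hn : ε * N.netInflow d i ≤ 0 := mul_nonpos_of_nonneg_of_nonpos (le_of_lt hε) hc
      have h1 := le_max_left (-(N.excess f i)) 0
      have h2 := le_max_right (-(N.excess f i)) 0
      rw [hwi]
      exact max_le (by linarith) (by linarith)
    · filter_upwards [eventually_lt_add_mul (c := N.netInflow d i) he] with ε hε
      rw [max_eq_right (by linarith), hwi, mul_zero, add_zero]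
      exact le_max_right _ _
  obtain ⟨ε, hg, hε, hpos⟩ :=
    ((hd.eventually_isPseudoflow hf).and (hmax.and self_mem_nhdsWithin)).exists
  refine ⟨f + ε • d, hg, ?_⟩
  calc N.kappa (f + ε • d)
      ≤ ∑ i, N.M i * (max (-(N.excess f i)) 0 + ε * w i) :=
        sum_le_sum fun i _ => mul_le_mul_of_nonneg_left (hε i) (N.M_pos i).le
    _ = N.kappa f + ε * ∑ i, N.M i * w i := by
        simp only [kappa, mul_add, sum_add_distrib, mul_sum, mul_left_comm]
    _ < N.kappa f := by linarith [mul_neg_of_pos_of_neg (show 0 < ε from hpos) hsum]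

theorem HasGAP.exists_kappa_lt {N : LinNet V} {f : V × V → ℝ} (hf : N.IsPseudoflow f)
    (h : N.HasGAP f) : ∃ g, N.IsPseudoflow g ∧ N.kappa g < N.kappa f := by
  rcases h with ⟨i, C, t, P, hC, hgain, hP, ht⟩ | ⟨s, t, P, hP, hs, ht⟩ | ⟨s, t, P, hP, -, ht, hM⟩
  · obtain ⟨d, hd, hd_in⟩ := hC.2.1.exists_dir
    obtain ⟨d', hd', hd'_in⟩ := hP.1.exists_dir
    have hin : N.netInflow (d + (N.gain C - 1) • d') =
        Pi.single t ((N.gain C - 1) * N.gain P) := by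
      rw [map_add, map_smul, hd_in, hd'_in, smul_sub, ← Pi.single_smul, ← Pi.single_smul,
        ← Pi.single_sub]
      simp
    refine (hd.add_smul hd' (sub_nonneg.2 hgain.le)).exists_kappa_lt hf
      (w := -Pi.single t ((N.gain C - 1) * N.gain P)) (fun j => Or.inl ⟨?_, ?_⟩) ?_
    · by_cases hj : j = t
      · exact Or.inl (hj ▸ ht)
      · simp [hin, hj]
    · rw [hin, Pi.neg_apply]
    · have := mul_pos (N.M_pos t) (mul_pos (sub_pos.2 hgain) hP.1.gain_pos)
      simpa [Pi.single_apply] using this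
  · obtain ⟨d, hd, hd_in⟩ := hP.1.exists_dir
    have hst : s ≠ t := by
      rintro rfl
      exact lt_asymm hs ht
    refine hd.exists_kappa_lt hf (w := -Pi.single t (N.gain P)) (fun j => ?_) ?_
    · by_cases hj : j = s
      · subst hj
        exact Or.inr ⟨hs, by simp [hst]⟩
      · refine Or.inl ⟨?_, by simp [hd_in, hj]⟩
        by_cases hjt : j = t
        · exact Or.inl (hjt ▸ ht)
        · simp [hd_in, hj, hjt]
    · have := mul_pos (N.M_pos t) hP.1.gain_pos
      simpa [Pi.single_apply] using this
  · obtain ⟨d, hd, hd_in⟩ := hP.1.exists_dir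
    refine hd.exists_kappa_lt hf (w := -N.netInflow d) (fun j => Or.inl ⟨?_, rfl⟩) ?_
    · by_cases hj : j = t
      · exact Or.inl (hj ▸ ht)
      · right
        rw [hd_in, Pi.sub_apply, Pi.single_eq_of_ne hj, zero_sub, neg_nonpos, Pi.single_apply]
        split_ifs <;> norm_num
    · rw [div_lt_iff₀ (N.M_pos t)] at hM
      simp only [hd_in, Pi.neg_apply, Pi.sub_apply, Pi.single_apply, neg_sub, mul_sub, mul_ite,
        mul_zero, mul_one, sum_sub_distrib, sum_ite_eq', mem_univ, if_true]
      linarith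

end LinNet

/-- If `f` is an optimal pseudoflow for the symmetric linear generalized
flow problem, then the residual graph contains no generalized augmenting path. -/
theorem optimal_no_GAP {V : Type*} [Fintype V] [DecidableEq V]
    (N : LinNet V) (f : V × V → ℝ)
    (hf : N.IsPseudoflow f)
    (hopt : ∀ g, N.IsPseudoflow g → N.kappa f ≤ N.kappa g) :
    ¬ N.HasGAP f := by
  intro h
  obtain ⟨g, hg, hlt⟩ := h.exists_kappa_lt hf
  exact (hopt g hg).not_gt hlt
end

section
/- Let f be a pseudoflow and μ a Δ-conservative labeling for f, and let 0≤Δ'<Δ. Then there exists a pseudoflow f̄ such that μ is a Δ'-conservative labeling for f̄ and Ex^μ_{Δ'}(f̄) ≤ Ex^μ_Δ(f) + 3m(Δ−Δ'). -/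
/-!
STATEMENT 0: If `f` is an optimal pseudoflow for the symmetric linear generalized flow
problem (i.e. it minimizes the excess discrepancy `κ_f` over all pseudoflows), then the
residual graph `E_f` contains no generalized augmenting path.
-/

open Finset

namespace LinNet

variable {V : Type*} [Fintype V] [DecidableEq V]

/-- `d_i`: the total number of incoming and outgoing arcs incident to `i`. -/
def deg (N : LinNet V) (i : V) : ℕ :=
  (N.E.filter (fun a => a.1 = i)).card + (N.E.filter (fun a => a.2 = i)).card

/-- The fatness of a residual arc: `γ_{ij}(u_{ij} − f_{ij})` on forward arcs and the
original flow value on backward arcs (the maximum possible flow increase at the head). -/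
noncomputable def fatness (N : LinNet V) (f : V × V → ℝ) (e : (V × V) × Bool) : ℝ :=
  if e.2 then N.γ e.1 * (N.u e.1 - f e.1) else f e.1

/-- The relabeled fatness `s^μ_f(ij) = s_f(ij)/μ_j`. -/
noncomputable def relFat (N : LinNet V) (f : V × V → ℝ) (μ : V → ℝ)
    (e : (V × V) × Bool) : ℝ :=
  N.fatness f e / μ (resHead e)

/-- `μ` is a `Δ`-conservative labeling for `f`: labels are positive, the relabeled gain is
at most `1` on every `Δ`-fat residual arc, `μ_i ≥ 1/M_i` for all nodes, and `μ_i = 1/M_i`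
for every `Δ`-negative node (i.e. whenever `e^μ_i < d_i Δ`). -/
def DeltaConservative (N : LinNet V) (f : V × V → ℝ) (μ : V → ℝ) (Δ : ℝ) : Prop :=
  (∀ i, 0 < μ i) ∧
  (∀ e, N.IsResArc f e → Δ ≤ N.relFat f μ e →
      N.resGain e * μ (resTail e) / μ (resHead e) ≤ 1) ∧
  (∀ i, 1 / N.M i ≤ μ i) ∧
  (∀ i, N.excess f i / μ i < (N.deg i : ℝ) * Δ → μ i = 1 / N.M i)

/-- The modified relabeled excess `Ex^μ_Δ(f) = Σ_i max{e^μ_i − d_i Δ, 0}`. -/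
noncomputable def ExDelta (N : LinNet V) (f : V × V → ℝ) (μ : V → ℝ) (Δ : ℝ) : ℝ :=
  ∑ i, max (N.excess f i / μ i - (N.deg i : ℝ) * Δ) 0

end LinNet

/-- Adjusting the flow on a single arc whose end nodes carry labels `p` and `q`: the relabeled
excess at either end drops by at most `Δ - Δ'`, and its total increase is at most `Δ - Δ'`. -/
theorem exists_arc_adjustment {u γ p q f Δ Δ' : ℝ} (hγ : 0 < γ) (hp : 0 < p) (hq : 0 < q)
    (hf0 : 0 ≤ f) (hfu : f ≤ u) (hΔ : Δ' < Δ)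
    (hfwd : f < u → Δ ≤ γ * (u - f) / q → γ * p / q ≤ 1)
    (hbwd : 0 < f → Δ ≤ f / p → γ⁻¹ * q / p ≤ 1) :
    ∃ x, (0 ≤ x ∧ x ≤ u) ∧
      (x < u → Δ' ≤ γ * (u - x) / q → γ * p / q ≤ 1) ∧
      (0 < x → Δ' ≤ x / p → γ⁻¹ * q / p ≤ 1) ∧
      -(Δ - Δ') ≤ γ * (x - f) / q ∧ -(Δ - Δ') ≤ -((x - f) / p) ∧
      max (γ * (x - f) / q) 0 + max (-((x - f) / p)) 0 ≤ Δ - Δ' := by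
  have hback : γ⁻¹ * q / p ≤ 1 ↔ q ≤ γ * p := by
    rw [div_le_one hp, inv_mul_le_iff₀ hγ]
  rw [hback] at hbwd ⊢
  rw [div_le_one hq] at hfwd ⊢
  rcases lt_trichotomy q (γ * p) with h | h | h
  · have key : ∀ x, f ≤ x → x ≤ u → γ * (x - f) / q ≤ Δ - Δ' →
        (x < u → γ * (u - x) / q < Δ') → ∃ x, (0 ≤ x ∧ x ≤ u) ∧
        (x < u → Δ' ≤ γ * (u - x) / q → γ * p ≤ q) ∧ (0 < x → Δ' ≤ x / p → q ≤ γ * p) ∧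
        -(Δ - Δ') ≤ γ * (x - f) / q ∧ -(Δ - Δ') ≤ -((x - f) / p) ∧
        max (γ * (x - f) / q) 0 + max (-((x - f) / p)) 0 ≤ Δ - Δ' := by
      intro x hfx hxu hle hfat
      have hd : 0 ≤ x - f := sub_nonneg.2 hfx
      have h1 : 0 ≤ γ * (x - f) / q := by positivity
      have h2 : 0 ≤ (x - f) / p := by positivity
      have h3 : (x - f) / p ≤ γ * (x - f) / q := by
        rw [div_le_div_iff₀ hp hq]
        nlinarith
      refine ⟨x, ⟨hf0.trans hfx, hxu⟩, fun hx hx' => absurd (hfat hx) (not_lt.2 hx'),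
        fun _ _ => h.le, by linarith, by linarith, ?_⟩
      rw [max_eq_left h1, max_eq_right (by linarith)]
      linarith
    by_cases hs : γ * (u - f) / q ≤ Δ - Δ'
    · exact key u hfu le_rfl hs fun hu => absurd hu (lt_irrefl u)
    · push Not at hs
      have hpos : 0 < (Δ - Δ') * q / γ := div_pos (mul_pos (sub_pos.2 hΔ) hq) hγ
      have hlt : (Δ - Δ') * q / γ < u - f := by
        rw [div_lt_iff₀ hγ]
        rw [lt_div_iff₀ hq] at hs
        linarith
      refine key (f + (Δ - Δ') * q / γ) (by linarith) (by linarith)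
        (le_of_eq (by field_simp; ring)) fun _ => ?_
      have hfat : γ * (u - f) / q < Δ := by
        by_contra hc
        exact absurd (hfwd (by linarith) (not_lt.1 hc)) (not_le.2 h)
      have heq : γ * (u - (f + (Δ - Δ') * q / γ)) / q = γ * (u - f) / q - (Δ - Δ') := by
        field_simp
        ring
      linarith
  · exact ⟨f, ⟨hf0, hfu⟩, fun _ _ => h.ge, fun _ _ => h.le, by simp [hΔ.le], by simp [hΔ.le],
      by simp [hΔ.le]⟩
  · have key : ∀ x, 0 ≤ x → x ≤ f → (f - x) / p ≤ Δ - Δ' →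
        (0 < x → x / p < Δ') → ∃ x, (0 ≤ x ∧ x ≤ u) ∧
        (x < u → Δ' ≤ γ * (u - x) / q → γ * p ≤ q) ∧ (0 < x → Δ' ≤ x / p → q ≤ γ * p) ∧
        -(Δ - Δ') ≤ γ * (x - f) / q ∧ -(Δ - Δ') ≤ -((x - f) / p) ∧
        max (γ * (x - f) / q) 0 + max (-((x - f) / p)) 0 ≤ Δ - Δ' := by
      intro x hx0 hxf hle hfat
      have hd : 0 ≤ f - x := sub_nonneg.2 hxf
      have h1 : 0 ≤ γ * (f - x) / q := by positivity
      have h2 : 0 ≤ (f - x) / p := by positivity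
      have h3 : γ * (f - x) / q ≤ (f - x) / p := by
        rw [div_le_div_iff₀ hq hp]
        nlinarith
      have h4 : γ * (x - f) / q = -(γ * (f - x) / q) := by ring
      have h5 : -((x - f) / p) = (f - x) / p := by ring
      rw [← h5] at h2 hle h3
      refine ⟨x, ⟨hx0, hxf.trans hfu⟩, fun _ _ => h.le,
        fun hx hx' => absurd (hfat hx) (not_lt.2 hx'), by linarith, by linarith, ?_⟩
      rw [max_eq_right (by linarith), max_eq_left h2]
      linarith
    by_cases hs : f / p ≤ Δ - Δ'
    · exact key 0 le_rfl hf0 (by simpa using hs) fun hu => absurd hu (lt_irrefl 0)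
    · push Not at hs
      have hpos : 0 < (Δ - Δ') * p := mul_pos (sub_pos.2 hΔ) hp
      have hlt : (Δ - Δ') * p < f := (lt_div_iff₀ hp).1 hs
      refine key (f - (Δ - Δ') * p) (by linarith) (by linarith)
        (le_of_eq (by field_simp; ring)) fun _ => ?_
      have hfat : f / p < Δ := by
        by_contra hc
        exact absurd (hbwd (by linarith) (not_lt.1 hc)) (not_le.2 h)
      have heq : (f - (Δ - Δ') * p) / p = f / p - (Δ - Δ') := by field_simp
      linarith

namespace LinNet

/-- The change of the relabeled excess of a node, as a sum over its incident arcs. -/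
theorem excess_div_eq {V : Type*} [Fintype V] [DecidableEq V] (N : LinNet V)
    (f g : V × V → ℝ) (μ : V → ℝ) (i : V) :
    N.excess g i / μ i = N.excess f i / μ i
      + (∑ a ∈ N.E with a.2 = i, N.γ a * (g a - f a) / μ a.2
        + ∑ a ∈ N.E with a.1 = i, -((g a - f a) / μ a.1)) := by
  have h1 : ∑ a ∈ N.E with a.2 = i, N.γ a * (g a - f a) / μ a.2
      = ∑ a ∈ N.E with a.2 = i, (N.γ a * g a / μ i - N.γ a * f a / μ i) :=
    sum_congr rfl fun a ha => by rw [(mem_filter.1 ha).2]; ring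
  have h2 : ∑ a ∈ N.E with a.1 = i, -((g a - f a) / μ a.1)
      = ∑ a ∈ N.E with a.1 = i, (f a / μ i - g a / μ i) :=
    sum_congr rfl fun a ha => by rw [(mem_filter.1 ha).2]; ring
  rw [h1, h2]
  simp only [sum_sub_distrib, ← sum_div, excess]
  ring

theorem sum_deg {V : Type*} [Fintype V] [DecidableEq V] (N : LinNet V) :
    ∑ i, (N.deg i : ℝ) = 2 * (N.E.card : ℝ) := by
  have h1 : ∑ i, #{a ∈ N.E | a.1 = i} = #N.E :=
    (card_eq_sum_card_fiberwise fun _ _ => mem_univ _).symm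
  have h2 : ∑ i, #{a ∈ N.E | a.2 = i} = #N.E :=
    (card_eq_sum_card_fiberwise fun _ _ => mem_univ _).symm
  simp only [deg, Nat.cast_add, sum_add_distrib, ← Nat.cast_sum, h1, h2]
  ring

end LinNet

/-- If `μ` is a `Δ`-conservative labeling for the pseudoflow `f` and
`0 ≤ Δ' < Δ`, then there is a pseudoflow `f̄` such that `μ` is `Δ'`-conservative for `f̄`
and `Ex^μ_{Δ'}(f̄) ≤ Ex^μ_Δ(f) + 3m(Δ−Δ')`. -/
theorem delta_adjust {V : Type*} [Fintype V] [DecidableEq V]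
    (N : LinNet V) (f : V × V → ℝ) (μ : V → ℝ) (Δ Δ' : ℝ)
    (hf : N.IsPseudoflow f) (hcons : N.DeltaConservative f μ Δ)
    (hΔ'0 : 0 ≤ Δ') (hΔ'Δ : Δ' < Δ) :
    ∃ fb, N.IsPseudoflow fb ∧ N.DeltaConservative fb μ Δ' ∧
      N.ExDelta fb μ Δ' ≤ N.ExDelta f μ Δ + 3 * (N.E.card : ℝ) * (Δ - Δ') := by
  obtain ⟨hμ, hgain, hM, hneg⟩ := hcons
  have harc : ∀ a : V × V, ∃ x, a ∈ N.E → (0 ≤ x ∧ x ≤ N.u a) ∧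
      (x < N.u a → Δ' ≤ N.γ a * (N.u a - x) / μ a.2 → N.γ a * μ a.1 / μ a.2 ≤ 1) ∧
      (0 < x → Δ' ≤ x / μ a.1 → (N.γ a)⁻¹ * μ a.2 / μ a.1 ≤ 1) ∧
      -(Δ - Δ') ≤ N.γ a * (x - f a) / μ a.2 ∧ -(Δ - Δ') ≤ -((x - f a) / μ a.1) ∧
      max (N.γ a * (x - f a) / μ a.2) 0 + max (-((x - f a) / μ a.1)) 0 ≤ Δ - Δ' := by
    intro a
    by_cases ha : a ∈ N.E
    · obtain ⟨x, hx⟩ := exists_arc_adjustment (N.γ_pos a ha) (hμ a.1) (hμ a.2) (hf a ha).1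
        (hf a ha).2 hΔ'Δ
        (fun h h' => by
          have := hgain (a, true) ⟨ha, by simpa using h⟩
            (by simpa [LinNet.relFat, LinNet.fatness, LinNet.resHead] using h')
          simpa [LinNet.resGain, LinNet.resTail, LinNet.resHead] using this)
        (fun h h' => by
          have := hgain (a, false) ⟨ha, by simpa using h⟩
            (by simpa [LinNet.relFat, LinNet.fatness, LinNet.resHead] using h')
          simpa [LinNet.resGain, LinNet.resTail, LinNet.resHead] using this)
      exact ⟨x, fun _ => hx⟩
    · exact ⟨0, fun h => absurd h ha⟩
  choose g hg using harc
  refine ⟨g, fun a ha => (hg a ha).1, ⟨hμ, ?_, hM, fun i hi => hneg i ?_⟩, ?_⟩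
  · rintro ⟨a, _ | _⟩ ⟨ha, hres⟩ hfat
    · simpa [LinNet.resGain, LinNet.resTail, LinNet.resHead] using
        (hg a ha).2.2.1 (by simpa using hres)
          (by simpa [LinNet.relFat, LinNet.fatness, LinNet.resHead] using hfat)
    · simpa [LinNet.resGain, LinNet.resTail, LinNet.resHead] using
        (hg a ha).2.1 (by simpa using hres)
          (by simpa [LinNet.relFat, LinNet.fatness, LinNet.resHead] using hfat)
  · have h1 := card_nsmul_le_sum {a ∈ N.E | a.2 = i} (fun a => N.γ a * (g a - f a) / μ a.2)
      (-(Δ - Δ')) fun a ha => (hg a (mem_filter.1 ha).1).2.2.2.1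
    have h2 := card_nsmul_le_sum {a ∈ N.E | a.1 = i} (fun a => -((g a - f a) / μ a.1))
      (-(Δ - Δ')) fun a ha => (hg a (mem_filter.1 ha).1).2.2.2.2.1
    rw [N.excess_div_eq f g μ i] at hi
    simp only [nsmul_eq_mul] at h1 h2
    simp only [LinNet.deg, Nat.cast_add] at hi ⊢
    linarith
  · set P : V × V → ℝ := fun a => max (N.γ a * (g a - f a) / μ a.2) 0
    set Q : V × V → ℝ := fun a => max (-((g a - f a) / μ a.1)) 0
    have hnode : ∀ i, max (N.excess g i / μ i - (N.deg i : ℝ) * Δ') 0 ≤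
        max (N.excess f i / μ i - (N.deg i : ℝ) * Δ) 0 +
          (∑ a ∈ N.E with a.2 = i, P a + ∑ a ∈ N.E with a.1 = i, Q a) +
          (N.deg i : ℝ) * (Δ - Δ') := by
      intro i
      have h1 : ∑ a ∈ N.E with a.2 = i, N.γ a * (g a - f a) / μ a.2 ≤
          ∑ a ∈ N.E with a.2 = i, P a := sum_le_sum fun a _ => le_max_left _ _
      have h2 : ∑ a ∈ N.E with a.1 = i, -((g a - f a) / μ a.1) ≤
          ∑ a ∈ N.E with a.1 = i, Q a := sum_le_sum fun a _ => le_max_left _ _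
      have h3 : 0 ≤ ∑ a ∈ N.E with a.2 = i, P a := sum_nonneg fun a _ => le_max_right _ _
      have h4 : 0 ≤ ∑ a ∈ N.E with a.1 = i, Q a := sum_nonneg fun a _ => le_max_right _ _
      have h5 : 0 ≤ (N.deg i : ℝ) * (Δ - Δ') :=
        mul_nonneg (Nat.cast_nonneg _) (sub_nonneg.2 hΔ'Δ.le)
      have h6 := le_max_left (N.excess f i / μ i - (N.deg i : ℝ) * Δ) 0
      have h7 := le_max_right (N.excess f i / μ i - (N.deg i : ℝ) * Δ) 0
      rw [N.excess_div_eq f g μ i]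
      exact max_le (by linarith) (by linarith)
    have hsum := sum_le_sum fun i (_ : i ∈ (univ : Finset V)) => hnode i
    rw [sum_add_distrib, sum_add_distrib, sum_add_distrib, sum_fiberwise, sum_fiberwise,
      ← sum_mul, N.sum_deg, ← sum_add_distrib] at hsum
    have harcs := sum_le_card_nsmul N.E (fun a => P a + Q a) (Δ - Δ')
      fun a ha => (hg a ha).2.2.2.2.2
    rw [nsmul_eq_mul] at harcs
    unfold LinNet.ExDelta
    linarith
end

section
/- If f is an optimal pseudoflow for the symmetric concave generalized flow problem (i.e. f minimizes the excess discrepancy κ_f over all pseudoflows), then the residual graph E_f contains no generalized augmenting path. -/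
open Finset

/-- The right derivative of a concave function `g` at `x`, with domain bounded above by
`hi`: the supremum of the difference quotients `(g(x+h) − g(x))/h` over `0 < h ≤ hi − x`
(for a concave function these quotients are nonincreasing in `h`). -/
noncomputable def slopeR (g : ℝ → ℝ) (x hi : ℝ) : ℝ :=
  sSup ((fun h => (g (x + h) - g x) / h) '' Set.Ioc 0 (hi - x))

/-- The left derivative of a concave function `g` at `x`, with domain bounded below by
`lo`: the infimum of the difference quotients `(g(x) − g(x−h))/h` over `0 < h ≤ x − lo`. -/
noncomputable def slopeL (g : ℝ → ℝ) (x lo : ℝ) : ℝ :=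
  sInf ((fun h => (g x - g (x - h)) / h) '' Set.Ioc 0 (x - lo))

/-- A concave generalized flow network: on each arc a concave, strictly monotone
increasing, continuous gain function `Γ_{ij} : [0, u_{ij}] → ℝ`. -/
structure CNet (V : Type*) [Fintype V] [DecidableEq V] where
  /-- the arc set -/
  E : Finset (V × V)
  /-- upper capacities -/
  u : V × V → ℝ
  /-- gain functions -/
  Γ : V × V → ℝ → ℝ
  /-- node demands -/
  b : V → ℝ
  /-- penalty factors -/
  M : V → ℝ
  u_nonneg : ∀ a ∈ E, 0 ≤ u a
  concave : ∀ a ∈ E, ConcaveOn ℝ (Set.Icc 0 (u a)) (Γ a)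
  mono : ∀ a ∈ E, StrictMonoOn (Γ a) (Set.Icc 0 (u a))
  cont : ∀ a ∈ E, ContinuousOn (Γ a) (Set.Icc 0 (u a))
  M_pos : ∀ i, 0 < M i

namespace CNet

variable {V : Type*} [Fintype V] [DecidableEq V]

/-- A pseudoflow: `0 ≤ f ≤ u` on every arc. -/
def IsPseudoflow (N : CNet V) (f : V × V → ℝ) : Prop :=
  ∀ a ∈ N.E, 0 ≤ f a ∧ f a ≤ N.u a

/-- The excess `e_i = Σ_{ji∈E} Γ_{ji}(f_{ji}) − Σ_{ij∈E} f_{ij} − b_i`. -/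
noncomputable def excess (N : CNet V) (f : V × V → ℝ) (i : V) : ℝ :=
  ∑ a ∈ N.E.filter (fun a => a.2 = i), N.Γ a (f a)
    - ∑ a ∈ N.E.filter (fun a => a.1 = i), f a - N.b i

/-- The excess discrepancy `κ_f = Σ_i M_i · max{−e_i, 0}`. -/
noncomputable def kappa (N : CNet V) (f : V × V → ℝ) : ℝ :=
  ∑ i, N.M i * max (-(N.excess f i)) 0

/-- The inverse `Γ_{ij}⁻¹` of the gain function of an arc. -/
noncomputable def Γinv (N : CNet V) (a : V × V) : ℝ → ℝ :=
  Function.invFunOn (N.Γ a) (Set.Icc 0 (N.u a))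

/-- A residual arc is an original arc together with a direction:
`true` = forward copy, `false` = backward copy. -/
def resTail (e : (V × V) × Bool) : V := if e.2 then e.1.1 else e.1.2

def resHead (e : (V × V) × Bool) : V := if e.2 then e.1.2 else e.1.1

/-- Membership in the residual graph `E_f`. -/
def IsResArc (N : CNet V) (f : V × V → ℝ) (e : (V × V) × Bool) : Prop :=
  e.1 ∈ N.E ∧ (if e.2 then f e.1 < N.u e.1 else 0 < f e.1)

/-- The right derivative `Γ^+_e(f_e)` of the gain function of a residual arc: on a forward
arc the right derivative of `Γ_{ij}` at `f_{ij}`; on the backward arc the right derivative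
of `Γ_{ji}(α) = −Γ_{ij}⁻¹(−α)` at `f_{ji} = −Γ_{ij}(f_{ij})`. -/
noncomputable def resDeriv (N : CNet V) (f : V × V → ℝ) (e : (V × V) × Bool) : ℝ :=
  if e.2 then slopeR (N.Γ e.1) (f e.1) (N.u e.1)
  else slopeR (fun α => -(N.Γinv e.1 (-α))) (-(N.Γ e.1 (f e.1))) (-(N.Γ e.1 0))

/-- `Γ^+_f(P)`: the product of the right derivatives along a walk. -/
noncomputable def gainDeriv (N : CNet V) (f : V × V → ℝ)
    (L : List ((V × V) × Bool)) : ℝ :=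
  (L.map (N.resDeriv f)).prod

/-- `IsResWalk N f s t L`: `L` is a walk in the residual graph `E_f` from `s` to `t`. -/
def IsResWalk (N : CNet V) (f : V × V → ℝ) : V → V → List ((V × V) × Bool) → Prop
  | s, t, [] => s = t
  | s, t, e :: L => N.IsResArc f e ∧ resTail e = s ∧ N.IsResWalk f (resHead e) t L

/-- A path in `E_f` from `s` to `t`: a walk with pairwise distinct vertices. -/
def IsResPath (N : CNet V) (f : V × V → ℝ) (s t : V) (L : List ((V × V) × Bool)) : Prop :=
  N.IsResWalk f s t L ∧ (s :: L.map resHead).Nodup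

/-- A cycle through `i` in `E_f`: a nonempty closed walk whose vertices are distinct. -/
def IsResCycle (N : CNet V) (f : V × V → ℝ) (i : V) (L : List ((V × V) × Bool)) : Prop :=
  L ≠ [] ∧ N.IsResWalk f i i L ∧ (L.map resHead).Nodup

/-- `E_f` contains a generalized augmenting path (GAP):
(a) a flow-generating cycle (`Γ^+_f(C) > 1`) together with a (possibly empty) path to a
node of negative excess;
(b) a path from a node of positive excess to a node of negative excess;
(c) a path `P` from `s` with `e_s ≤ 0` to `t` with `e_t < 0` such that
`Γ^+_f(P) > M_s/M_t`. -/
def HasGAP (N : CNet V) (f : V × V → ℝ) : Prop :=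
  (∃ i C t P, N.IsResCycle f i C ∧ 1 < N.gainDeriv f C ∧
      N.IsResPath f i t P ∧ N.excess f t < 0) ∨
  (∃ s t P, N.IsResPath f s t P ∧ 0 < N.excess f s ∧ N.excess f t < 0) ∨
  (∃ s t P, N.IsResPath f s t P ∧ N.excess f s ≤ 0 ∧ N.excess f t < 0 ∧
      N.M s / N.M t < N.gainDeriv f P)

end CNet

/-- A concave function lies above its chords (division-free form). -/
lemma ConcaveOn.chord_le {g : ℝ → ℝ} {s : Set ℝ} (hg : ConcaveOn ℝ s g) {x y z : ℝ}
    (hx : x ∈ s) (hy : y ∈ s) (hxy : x < y) (hxz : x ≤ z) (hzy : z ≤ y) :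
    (y - z) * g x + (z - x) * g y ≤ (y - x) * g z := by
  have hpos : 0 < y - x := sub_pos.2 hxy
  have ha : 0 ≤ (y - z) / (y - x) := div_nonneg (by linarith) hpos.le
  have hb : 0 ≤ (z - x) / (y - x) := div_nonneg (by linarith) hpos.le
  have h := hg.2 hx hy ha hb (by field_simp; ring)
  have hz : ((y - z) / (y - x)) • x + ((z - x) / (y - x)) • y = z := by
    simp only [smul_eq_mul]; field_simp; ring
  rw [hz] at h
  simp only [smul_eq_mul] at h
  have h2 := mul_le_mul_of_nonneg_left h hpos.le
  calc (y - z) * g x + (z - x) * g y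
      = (y - x) * ((y - z) / (y - x) * g x + (z - x) / (y - x) * g y) := by
        field_simp
    _ ≤ _ := h2

/-- If some chord of `g` to the right of `x₀` has slope more than `c`, then all short chords to the
right of points near `x₀` have slope at least `c`. -/
lemma exists_forward_push {g : ℝ → ℝ} {u x₀ y₀ c ρ : ℝ}
    (hconc : ConcaveOn ℝ (Set.Icc 0 u) g) (hmono : StrictMonoOn g (Set.Icc 0 u))
    (hcont : ContinuousOn g (Set.Icc 0 u)) (hx₀ : x₀ ∈ Set.Icc 0 u) (hy₀ : y₀ ∈ Set.Ioc x₀ u)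
    (hc : 0 < c) (hslope : c * (y₀ - x₀) < g y₀ - g x₀) (hρ : 0 < ρ) :
    ∃ η > 0, η ≤ ρ ∧ ∀ x ∈ Set.Icc 0 u, |x - x₀| < η → |g x - g x₀| < η →
      ∀ δ, 0 < δ → δ < η → x + δ ∈ Set.Icc 0 u ∧ |x + δ - x₀| < ρ ∧
        |g (x + δ) - g x₀| < ρ ∧ c * δ ≤ g (x + δ) - g x := by
  obtain ⟨hx0, hxu⟩ := hx₀
  obtain ⟨hxy, hyu⟩ := hy₀
  obtain ⟨ε, hε, hclose⟩ := Metric.continuousWithinAt_iff.1 (hcont x₀ ⟨hx0, hxu⟩) ρ hρ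
  obtain ⟨y, hy1, hy2, hy3, hy4⟩ : ∃ y, x₀ < y ∧ y ≤ y₀ ∧ y - x₀ < ε ∧ y - x₀ < ρ := by
    have h : 0 < min (y₀ - x₀) (min (ε / 2) (ρ / 2)) := by
      refine lt_min (by linarith) (lt_min (by linarith) (by linarith))
    have h1 := min_le_left (y₀ - x₀) (min (ε / 2) (ρ / 2))
    have h2 := (min_le_right (y₀ - x₀) (min (ε / 2) (ρ / 2))).trans (min_le_left _ _)
    have h3 := (min_le_right (y₀ - x₀) (min (ε / 2) (ρ / 2))).trans (min_le_right _ _)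
    exact ⟨x₀ + min (y₀ - x₀) (min (ε / 2) (ρ / 2)), by linarith, by linarith, by linarith,
      by linarith⟩
  have hyI : y ∈ Set.Icc 0 u := ⟨by linarith, by linarith⟩
  have hgy := hclose hyI (by rw [Real.dist_eq, abs_of_pos (by linarith)]; exact hy3)
  rw [Real.dist_eq, abs_lt] at hgy
  have hgap : 0 < g y - g x₀ - c * (y - x₀) := by
    have h := hconc.chord_le (z := y) ⟨hx0, hxu⟩ ⟨by linarith, hyu⟩ hxy hy1.le hy2
    have h' := mul_lt_mul_of_pos_left hslope (sub_pos.2 hy1)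
    have : 0 < (y₀ - x₀) * (g y - g x₀ - c * (y - x₀)) := by nlinarith
    exact pos_of_mul_pos_right this (by linarith)
  set K := (g y - g x₀ - c * (y - x₀)) / (1 + c) with hK
  have hKpos : 0 < K := div_pos hgap (by linarith)
  have hKeq : K * (1 + c) = g y - g x₀ - c * (y - x₀) := by rw [hK]; field_simp
  refine ⟨min ρ (min ((y - x₀) / 2) K), lt_min hρ (lt_min (by linarith) hKpos),
    min_le_left _ _, ?_⟩
  intro x hx hxx hgx δ hδ hδη
  have e1 := min_le_left ρ (min ((y - x₀) / 2) K)
  have e2 := (min_le_right ρ (min ((y - x₀) / 2) K)).trans (min_le_left _ _)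
  have e3 := (min_le_right ρ (min ((y - x₀) / 2) K)).trans (min_le_right _ _)
  set η := min ρ (min ((y - x₀) / 2) K)
  rw [abs_lt] at hxx hgx
  have hxI : x + δ ∈ Set.Icc 0 u := ⟨by linarith [hx.1], by linarith [hyI.2]⟩
  have m1 := hmono hx hxI (by linarith)
  have m2 := hmono.monotoneOn hxI hyI (by linarith)
  refine ⟨hxI, abs_lt.2 ⟨by linarith, by linarith⟩, abs_lt.2 ⟨by linarith, by linarith⟩, ?_⟩
  have hch := hconc.chord_le (z := x + δ) hx hyI (by linarith) (by linarith) (by linarith)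
  have hs : c * (y - x) ≤ g y - g x := by nlinarith
  have hs' := mul_le_mul_of_nonneg_left hs hδ.le
  have : 0 ≤ (y - x) * (g (x + δ) - g x - c * δ) := by nlinarith
  have := nonneg_of_mul_nonneg_right this (by linarith)
  linarith

/-- If some chord of `g` to the left of `x₀` has inverse slope more than `c`, then all short chords
to the left of points near `x₀` have inverse slope at least `c`. -/
lemma exists_backward_push {g : ℝ → ℝ} {u x₀ y₀ c ρ : ℝ}
    (hconc : ConcaveOn ℝ (Set.Icc 0 u) g) (hmono : StrictMonoOn g (Set.Icc 0 u))
    (hcont : ContinuousOn g (Set.Icc 0 u)) (hx₀ : x₀ ∈ Set.Icc 0 u) (hy₀ : y₀ ∈ Set.Ico 0 x₀)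
    (hc : 0 < c) (hslope : c * (g x₀ - g y₀) < x₀ - y₀) (hρ : 0 < ρ) :
    ∃ η > 0, η ≤ ρ ∧ ∀ x ∈ Set.Icc 0 u, |x - x₀| < η → |g x - g x₀| < η →
      ∀ δ, 0 < δ → δ < η → ∃ z ∈ Set.Icc 0 u, g z = g x - δ ∧ |z - x₀| < ρ ∧
        |g z - g x₀| < ρ ∧ c * δ ≤ x - z := by
  obtain ⟨hx0, hxu⟩ := hx₀
  obtain ⟨hy0, hyx⟩ := hy₀
  obtain ⟨ε, hε, hclose⟩ := Metric.continuousWithinAt_iff.1 (hcont x₀ ⟨hx0, hxu⟩) ρ hρ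
  obtain ⟨y, hy1, hy2, hy3, hy4⟩ : ∃ y, y < x₀ ∧ y₀ ≤ y ∧ x₀ - y < ε ∧ x₀ - y < ρ := by
    have h : 0 < min (x₀ - y₀) (min (ε / 2) (ρ / 2)) := by
      refine lt_min (by linarith) (lt_min (by linarith) (by linarith))
    have h1 := min_le_left (x₀ - y₀) (min (ε / 2) (ρ / 2))
    have h2 := (min_le_right (x₀ - y₀) (min (ε / 2) (ρ / 2))).trans (min_le_left _ _)
    have h3 := (min_le_right (x₀ - y₀) (min (ε / 2) (ρ / 2))).trans (min_le_right _ _)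
    exact ⟨x₀ - min (x₀ - y₀) (min (ε / 2) (ρ / 2)), by linarith, by linarith, by linarith,
      by linarith⟩
  have hyI : y ∈ Set.Icc 0 u := ⟨by linarith, by linarith⟩
  have hgy := hclose hyI (by rw [Real.dist_eq, abs_of_neg (by linarith)]; linarith)
  rw [Real.dist_eq, abs_lt] at hgy
  have hlt : g y < g x₀ := hmono hyI ⟨hx0, hxu⟩ hy1
  have hgap : 0 < x₀ - y - c * (g x₀ - g y) := by
    have h := hconc.chord_le (z := y) ⟨hy0, by linarith⟩ ⟨hx0, hxu⟩ hyx hy2 hy1.le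
    have h' := mul_lt_mul_of_pos_left hslope (sub_pos.2 hy1)
    have h'' := mul_le_mul_of_nonneg_left h hc.le
    have : 0 < (x₀ - y₀) * (x₀ - y - c * (g x₀ - g y)) := by nlinarith
    exact pos_of_mul_pos_right this (by linarith)
  set K := (x₀ - y - c * (g x₀ - g y)) / (1 + c) with hK
  have hKpos : 0 < K := div_pos hgap (by linarith)
  have hKeq : K * (1 + c) = x₀ - y - c * (g x₀ - g y) := by rw [hK]; field_simp
  refine ⟨min ρ (min ((g x₀ - g y) / 2) K), lt_min hρ (lt_min (by linarith) hKpos),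
    min_le_left _ _, ?_⟩
  intro x hx hxx hgx δ hδ hδη
  have e1 := min_le_left ρ (min ((g x₀ - g y) / 2) K)
  have e2 := (min_le_right ρ (min ((g x₀ - g y) / 2) K)).trans (min_le_left _ _)
  have e3 := (min_le_right ρ (min ((g x₀ - g y) / 2) K)).trans (min_le_right _ _)
  set η := min ρ (min ((g x₀ - g y) / 2) K)
  rw [abs_lt] at hxx hgx
  have hyx' : y < x := (hmono.lt_iff_lt hyI hx).1 (by linarith)
  obtain ⟨z, ⟨hz1, hz2⟩, hz⟩ := intermediate_value_Icc hyx'.le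
    (hcont.mono (Set.Icc_subset_Icc hyI.1 hx.2)) (show g x - δ ∈ Set.Icc (g y) (g x) from
      ⟨by linarith, by linarith⟩)
  refine ⟨z, ⟨by linarith [hyI.1], by linarith [hx.2]⟩, hz, abs_lt.2 ⟨by linarith, by linarith⟩,
    abs_lt.2 ⟨by linarith, by linarith⟩, ?_⟩
  have hch := hconc.chord_le (z := z) hyI hx hyx' hz1 hz2
  have hs : c * (g x - g y) ≤ x - y := by nlinarith
  have hs' := mul_le_mul_of_nonneg_left hs (sub_nonneg.2 hz2)
  rw [hz] at hch
  have hch' := mul_le_mul_of_nonneg_left hch hc.le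
  have : 0 ≤ (x - y) * (x - z - c * δ) := by nlinarith
  have := nonneg_of_mul_nonneg_right this (by linarith)
  linarith

namespace CNet

variable {V : Type*} [Fintype V] [DecidableEq V]

/-- `g` is `ρ`-close to `f`, both in arc flows and in arriving flows. -/
def Close (N : CNet V) (f g : V × V → ℝ) (ρ : ℝ) : Prop :=
  ∀ a ∈ N.E, |g a - f a| < ρ ∧ |N.Γ a (g a) - N.Γ a (f a)| < ρ

/-- Near `f`, every sufficiently small amount `δ` can be sent from `s` so that at least `c * δ`
arrives at `t` and no other excess changes. -/
def CanPush (N : CNet V) (f : V × V → ℝ) (s t : V) (c : ℝ) : Prop :=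
  ∀ ρ > 0, ∃ η > 0, ∀ g, N.IsPseudoflow g → N.Close f g η → ∀ δ, 0 < δ → δ < η →
    ∃ g' γ, N.IsPseudoflow g' ∧ N.Close f g' ρ ∧ c * δ ≤ γ ∧ γ < ρ ∧
      ∀ v, N.excess g' v
        = N.excess g v - (if s = v then δ else 0) + (if t = v then γ else 0)

lemma close_self (N : CNet V) (f : V × V → ℝ) {ρ : ℝ} (hρ : 0 < ρ) : N.Close f f ρ := by
  intro a _; simpa using hρ

lemma Close.update {N : CNet V} {f g : V × V → ℝ} {ρ η : ℝ} (h : N.Close f g η) (hle : η ≤ ρ)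
    {a : V × V} {z : ℝ} (hz : |z - f a| < ρ) (hΓ : |N.Γ a z - N.Γ a (f a)| < ρ) :
    N.Close f (Function.update g a z) ρ := by
  intro a' ha'
  by_cases hEq : a' = a
  · subst hEq; simpa using ⟨hz, hΓ⟩
  · simpa [hEq] using ⟨(h a' ha').1.trans_le hle, (h a' ha').2.trans_le hle⟩

lemma IsPseudoflow.update {N : CNet V} {g : V × V → ℝ} (h : N.IsPseudoflow g)
    {a : V × V} {z : ℝ} (hz : z ∈ Set.Icc 0 (N.u a)) :
    N.IsPseudoflow (Function.update g a z) := by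
  intro a' ha'
  by_cases hEq : a' = a
  · subst hEq; simpa using hz
  · simpa [hEq] using h a' ha'

lemma excess_update (N : CNet V) (g : V × V → ℝ) {a : V × V} (ha : a ∈ N.E) (z : ℝ) (v : V) :
    N.excess (Function.update g a z) v
      = N.excess g v - (if a.1 = v then z - g a else 0)
        + (if a.2 = v then N.Γ a z - N.Γ a (g a) else 0) := by
  have key : ∀ (F : V × V → ℝ → ℝ) (p : V × V → Prop) [DecidablePred p],
      ∑ a' ∈ N.E.filter p, F a' (Function.update g a z a')
        = ∑ a' ∈ N.E.filter p, F a' (g a') + (if p a then F a z - F a (g a) else 0) := by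
    intro F p _
    rw [← sub_eq_iff_eq_add', ← Finset.sum_sub_distrib, Finset.sum_filter,
      Finset.sum_eq_single_of_mem a ha]
    · simp
    · intro b _ hb
      simp [hb]
  unfold excess
  rw [key N.Γ (fun a => a.2 = v), key (fun _ x => x) (fun a => a.1 = v)]
  ring

lemma canPush_refl (N : CNet V) (f : V × V → ℝ) (s : V) {c : ℝ} (hc : c ≤ 1) :
    N.CanPush f s s c := by
  intro ρ hρ
  refine ⟨ρ, hρ, fun g hg hgc δ hδ hδρ => ⟨g, δ, hg, hgc, by nlinarith, hδρ, fun v => by ring⟩⟩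

lemma CanPush.trans {N : CNet V} {f : V × V → ℝ} {s m t : V} {c₁ c₂ : ℝ}
    (h₁ : N.CanPush f s m c₁) (h₂ : N.CanPush f m t c₂) (hc₁ : 0 < c₁) (hc₂ : 0 < c₂) :
    N.CanPush f s t (c₁ * c₂) := by
  intro ρ hρ
  obtain ⟨η₂, hη₂, H₂⟩ := h₂ ρ hρ
  obtain ⟨η₁, hη₁, H₁⟩ := h₁ η₂ hη₂
  refine ⟨η₁, hη₁, fun g hg hgc δ hδ hδη => ?_⟩
  obtain ⟨g₁, γ₁, hg₁, hgc₁, hγ₁, hγη₁, hex₁⟩ := H₁ g hg hgc δ hδ hδη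
  have hγpos : 0 < γ₁ := (mul_pos hc₁ hδ).trans_le hγ₁
  obtain ⟨g₂, γ₂, hg₂, hgc₂, hγ₂, hγη₂, hex₂⟩ := H₂ g₁ hg₁ hgc₁ γ₁ hγpos hγη₁
  refine ⟨g₂, γ₂, hg₂, hgc₂, by nlinarith, hγη₂, fun v => ?_⟩
  rw [hex₂, hex₁]; ring

lemma canPush_forward {N : CNet V} {f : V × V → ℝ} (hf : N.IsPseudoflow f) {a : V × V}
    (ha : a ∈ N.E) {y c : ℝ} (hy : y ∈ Set.Ioc (f a) (N.u a)) (hc : 0 < c)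
    (hslope : c * (y - f a) < N.Γ a y - N.Γ a (f a)) : N.CanPush f a.1 a.2 c := by
  intro ρ hρ
  obtain ⟨η, hη, hηρ, H⟩ := exists_forward_push (N.concave a ha) (N.mono a ha) (N.cont a ha)
    (hf a ha) hy hc hslope (half_pos hρ)
  refine ⟨η, hη, fun g hg hgc δ hδ hδη => ?_⟩
  obtain ⟨hz, h1, h2, h3⟩ := H (g a) (hg a ha) (hgc a ha).1 (hgc a ha).2 δ hδ hδη
  refine ⟨Function.update g a (g a + δ), N.Γ a (g a + δ) - N.Γ a (g a), hg.update hz,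
    hgc.update (by linarith) (by linarith) (by linarith), h3, ?_, fun v => ?_⟩
  · have := abs_lt.1 h2
    have := abs_lt.1 (hgc a ha).2
    linarith
  · rw [excess_update N g ha]; simp

lemma canPush_backward {N : CNet V} {f : V × V → ℝ} (hf : N.IsPseudoflow f) {a : V × V}
    (ha : a ∈ N.E) {y c : ℝ} (hy : y ∈ Set.Ico 0 (f a)) (hc : 0 < c)
    (hslope : c * (N.Γ a (f a) - N.Γ a y) < f a - y) : N.CanPush f a.2 a.1 c := by
  intro ρ hρ
  obtain ⟨η, hη, hηρ, H⟩ := exists_backward_push (N.concave a ha) (N.mono a ha) (N.cont a ha)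
    (hf a ha) hy hc hslope (half_pos hρ)
  refine ⟨η, hη, fun g hg hgc δ hδ hδη => ?_⟩
  obtain ⟨z, hz, hzδ, h1, h2, h3⟩ := H (g a) (hg a ha) (hgc a ha).1 (hgc a ha).2 δ hδ hδη
  refine ⟨Function.update g a z, g a - z, hg.update hz,
    hgc.update (by linarith) (by linarith) (by linarith), h3, ?_, fun v => ?_⟩
  · have := abs_lt.1 h1
    have := abs_lt.1 (hgc a ha).1
    linarith
  · rw [excess_update N g ha, hzδ]
    split_ifs <;> ring

lemma exists_Γinv {N : CNet V} {f : V × V → ℝ} (hf : N.IsPseudoflow f) {a : V × V}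
    (ha : a ∈ N.E) {h : ℝ} (hh : h ∈ Set.Ioc 0 (N.Γ a (f a) - N.Γ a 0)) :
    N.Γinv a (N.Γ a (f a) - h) ∈ Set.Ico 0 (f a) ∧
      N.Γ a (N.Γinv a (N.Γ a (f a) - h)) = N.Γ a (f a) - h := by
  have hfa := hf a ha
  obtain ⟨z, hz, hze⟩ := intermediate_value_Icc hfa.1
    ((N.cont a ha).mono (Set.Icc_subset_Icc le_rfl hfa.2))
    (show N.Γ a (f a) - h ∈ Set.Icc (N.Γ a 0) (N.Γ a (f a)) from
      ⟨by linarith [hh.2], by linarith [hh.1]⟩)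
  have hex : ∃ z ∈ Set.Icc 0 (N.u a), N.Γ a z = N.Γ a (f a) - h :=
    ⟨z, ⟨hz.1, hz.2.trans hfa.2⟩, hze⟩
  have hmem : N.Γinv a (N.Γ a (f a) - h) ∈ Set.Icc 0 (N.u a) := Function.invFunOn_mem hex
  have heq : N.Γ a (N.Γinv a (N.Γ a (f a) - h)) = N.Γ a (f a) - h := Function.invFunOn_eq hex
  exact ⟨⟨hmem.1, ((N.mono a ha).lt_iff_lt hmem hfa).1 (by linarith [hh.1])⟩, heq⟩

lemma Γinv_apply {N : CNet V} {f : V × V → ℝ} (hf : N.IsPseudoflow f) {a : V × V}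
    (ha : a ∈ N.E) : N.Γinv a (N.Γ a (f a)) = f a :=
  (N.mono a ha).injOn.leftInvOn_invFunOn (hf a ha)

lemma resDeriv_nonneg {N : CNet V} {f : V × V → ℝ} (hf : N.IsPseudoflow f)
    {e : (V × V) × Bool} (he : N.IsResArc f e) : 0 ≤ N.resDeriv f e := by
  obtain ⟨a, d⟩ := e
  obtain ⟨ha, -⟩ := he
  have hfa := hf _ ha
  cases d
  · refine Real.sSup_nonneg ?_
    rintro _ ⟨h, hh, rfl⟩
    have hh' : h ∈ Set.Ioc 0 (N.Γ _ (f _) - N.Γ _ 0) := ⟨hh.1, by linarith [hh.2]⟩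
    have h1 := exists_Γinv hf ha hh'
    refine div_nonneg ?_ hh.1.le
    have harg : -(-(N.Γ a (f a)) + h) = N.Γ a (f a) - h := by ring
    simp only [harg, neg_neg, Γinv_apply hf ha]
    linarith [h1.1.2]
  · refine Real.sSup_nonneg ?_
    rintro _ ⟨h, hh, rfl⟩
    refine div_nonneg (sub_nonneg.2 ?_) hh.1.le
    exact (N.mono _ ha).monotoneOn hfa ⟨by linarith [hfa.1, hh.1], by linarith [hh.2]⟩
      (by linarith [hh.1])

lemma canPush_of_lt_resDeriv {N : CNet V} {f : V × V → ℝ} (hf : N.IsPseudoflow f)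
    {e : (V × V) × Bool} (he : N.IsResArc f e) {c : ℝ} (hc : 0 < c) (hlt : c < N.resDeriv f e) :
    N.CanPush f (resTail e) (resHead e) c := by
  obtain ⟨a, d⟩ := e
  obtain ⟨ha, hd⟩ := he
  have hfa := hf _ ha
  cases d
  · simp only [Bool.false_eq_true, if_false] at hd
    have hne : (Set.Ioc 0 (-(N.Γ a 0) - -(N.Γ a (f a)))).Nonempty :=
      ⟨_, ⟨by linarith [N.mono a ha ⟨le_rfl, N.u_nonneg a ha⟩ hfa hd], le_rfl⟩⟩
    obtain ⟨_, ⟨h, hh, rfl⟩, hq⟩ := exists_lt_of_lt_csSup (hne.image _) hlt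
    have hh' : h ∈ Set.Ioc 0 (N.Γ a (f a) - N.Γ a 0) := ⟨hh.1, by linarith [hh.2]⟩
    have h1 := exists_Γinv hf ha hh'
    have harg : -(-(N.Γ a (f a)) + h) = N.Γ a (f a) - h := by ring
    simp only [harg, neg_neg, Γinv_apply hf ha] at hq
    rw [lt_div_iff₀ hh.1] at hq
    exact canPush_backward hf ha h1.1 hc (by rw [h1.2]; linarith)
  · simp only [if_true] at hd
    have hne : (Set.Ioc 0 (N.u a - f a)).Nonempty := ⟨_, ⟨sub_pos.2 hd, le_rfl⟩⟩
    obtain ⟨_, ⟨h, hh, rfl⟩, hq⟩ := exists_lt_of_lt_csSup (hne.image _) hlt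
    rw [lt_div_iff₀ hh.1] at hq
    exact canPush_forward hf ha (y := f a + h) ⟨by linarith [hh.1], by linarith [hh.2]⟩ hc
      (by simpa using hq)

lemma exists_canPush_of_isResArc {N : CNet V} {f : V × V → ℝ} (hf : N.IsPseudoflow f)
    {e : (V × V) × Bool} (he : N.IsResArc f e) :
    ∃ c > 0, N.CanPush f (resTail e) (resHead e) c := by
  obtain ⟨a, d⟩ := e
  obtain ⟨ha, hd⟩ := he
  have hfa := hf _ ha
  have hu := N.u_nonneg a ha
  cases d
  · simp only [Bool.false_eq_true, if_false] at hd
    have hm := N.mono a ha ⟨le_rfl, hu⟩ hfa hd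
    obtain ⟨c, hc, hcl⟩ := exists_between (div_pos hd (sub_pos.2 hm))
    rw [lt_div_iff₀ (sub_pos.2 hm)] at hcl
    exact ⟨c, hc, canPush_backward hf ha (y := 0) ⟨le_rfl, hd⟩ hc (by simpa using hcl)⟩
  · simp only [if_true] at hd
    have hm := N.mono a ha hfa ⟨hu, le_rfl⟩ hd
    obtain ⟨c, hc, hcl⟩ := exists_between (div_pos (sub_pos.2 hm) (sub_pos.2 hd))
    rw [lt_div_iff₀ (sub_pos.2 hd)] at hcl
    exact ⟨c, hc, canPush_forward hf ha (y := N.u a) ⟨hd, le_rfl⟩ hc hcl⟩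

lemma exists_canPush_of_isResWalk {N : CNet V} {f : V × V → ℝ} (hf : N.IsPseudoflow f)
    {s t : V} {L : List ((V × V) × Bool)} (hL : N.IsResWalk f s t L) :
    ∃ c > 0, N.CanPush f s t c := by
  induction L generalizing s with
  | nil => cases hL; exact ⟨1, one_pos, N.canPush_refl f _ le_rfl⟩
  | cons e L ih =>
    obtain ⟨he, rfl, hL⟩ := hL
    obtain ⟨c₁, hc₁, h₁⟩ := exists_canPush_of_isResArc hf he
    obtain ⟨c₂, hc₂, h₂⟩ := ih hL
    exact ⟨c₁ * c₂, mul_pos hc₁ hc₂, h₁.trans h₂ hc₁ hc₂⟩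

lemma gainDeriv_nonneg {N : CNet V} {f : V × V → ℝ} (hf : N.IsPseudoflow f)
    {s t : V} {L : List ((V × V) × Bool)} (hL : N.IsResWalk f s t L) :
    0 ≤ N.gainDeriv f L := by
  induction L generalizing s with
  | nil => simp [gainDeriv]
  | cons e L ih =>
    obtain ⟨he, -, hL⟩ := hL
    simpa [gainDeriv] using mul_nonneg (resDeriv_nonneg hf he) (ih hL)

lemma canPush_of_lt_gainDeriv {N : CNet V} {f : V × V → ℝ} (hf : N.IsPseudoflow f)
    {s t : V} {L : List ((V × V) × Bool)} (hL : N.IsResWalk f s t L) {c : ℝ} (hc : 0 < c)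
    (hlt : c < N.gainDeriv f L) : N.CanPush f s t c := by
  induction L generalizing s c with
  | nil =>
    cases hL
    exact N.canPush_refl f _ (by simpa [gainDeriv] using hlt.le)
  | cons e L ih =>
    obtain ⟨he, rfl, hL⟩ := hL
    have hlt' : c < N.resDeriv f e * N.gainDeriv f L := by simpa [gainDeriv] using hlt
    have hd := resDeriv_nonneg hf he
    have hD : 0 < N.gainDeriv f L := by
      refine (gainDeriv_nonneg hf hL).lt_of_ne fun h => ?_
      rw [← h] at hlt'; linarith
    obtain ⟨c₁, hc₁, hc₁'⟩ := exists_between ((div_lt_iff₀ hD).2 hlt')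
    have hpos : 0 < c₁ := (div_pos hc hD).trans hc₁
    have hc₂ : c / c₁ < N.gainDeriv f L := by
      rw [div_lt_iff₀ hD] at hc₁
      rw [div_lt_iff₀ hpos]; linarith
    have := (canPush_of_lt_resDeriv hf he hpos hc₁').trans (ih hL (div_pos hc hpos) hc₂) hpos
      (div_pos hc hpos)
    rwa [mul_div_cancel₀ _ hpos.ne'] at this

/-- Moving excess from `s` to the deficient node `t` at a favourable rate lowers the discrepancy. -/
lemma kappa_lt_of_excess_eq {N : CNet V} {f g : V × V → ℝ} {s t : V} {δ γ : ℝ} (hδ : 0 ≤ δ)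
    (hγ : N.excess f t + γ ≤ 0) (hrate : N.M s * δ < N.M t * γ)
    (hex : ∀ v, N.excess g v
      = N.excess f v - (if s = v then δ else 0) + (if t = v then γ else 0)) :
    N.kappa g < N.kappa f := by
  have hle : N.kappa g ≤ ∑ v, (N.M v * max (-(N.excess f v)) 0
      + (if s = v then N.M v * δ else 0) - (if t = v then N.M v * γ else 0)) := by
    refine Finset.sum_le_sum fun v _ => ?_
    have hM := N.M_pos v
    have key : max (-(N.excess g v)) 0 ≤ max (-(N.excess f v)) 0
        + (if s = v then δ else 0) - (if t = v then γ else 0) := by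
      have hs : 0 ≤ if s = v then δ else 0 := by split_ifs <;> linarith
      rw [hex v]
      rcases eq_or_ne t v with rfl | htv
      · have := le_max_left (-(N.excess f t)) 0
        simp only [if_true]
        refine max_le ?_ ?_ <;> linarith
      · have h1 := le_max_left (-(N.excess f v)) 0
        have h2 := le_max_right (-(N.excess f v)) 0
        simp only [htv, if_false]
        refine max_le ?_ ?_ <;> linarith
    have := mul_le_mul_of_nonneg_left key hM.le
    simpa [mul_add, mul_sub, mul_ite] using this
  refine hle.trans_lt ?_
  rw [Finset.sum_sub_distrib, Finset.sum_add_distrib]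
  simp only [Finset.sum_ite_eq, Finset.mem_univ, if_true]
  unfold kappa
  linarith

end CNet

/-- If `f` is an optimal pseudoflow for the symmetric concave generalized
flow problem (it minimizes the excess discrepancy `κ_f` over all pseudoflows), then the
residual graph `E_f` contains no generalized augmenting path. -/
theorem optimal_no_GAP_concave {V : Type*} [Fintype V] [DecidableEq V]
    (N : CNet V) (f : V × V → ℝ)
    (hf : N.IsPseudoflow f)
    (hopt : ∀ g, N.IsPseudoflow g → N.kappa f ≤ N.kappa g) :
    ¬ N.HasGAP f := by
  rintro (⟨i, C, t, P, ⟨-, hC, -⟩, hgain, ⟨hP, -⟩, ht⟩ | ⟨s, t, P, ⟨hP, -⟩, hs, ht⟩ |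
    ⟨s, t, P, ⟨hP, -⟩, -, ht, hgain⟩)
  · obtain ⟨c, hc, hcG⟩ := exists_between hgain
    obtain ⟨c', hc', hpath⟩ := CNet.exists_canPush_of_isResWalk hf hP
    obtain ⟨η, hη, H⟩ := hpath (-N.excess f t) (by linarith)
    obtain ⟨θ, hθ, H'⟩ := CNet.canPush_of_lt_gainDeriv hf hC (by linarith) hcG η hη
    obtain ⟨δ, hδ, hδθ⟩ := exists_between hθ
    obtain ⟨g, γ, hg, hgc, hγ, hγη, hex⟩ := H' f hf (N.close_self f hθ) δ hδ hδθ
    have hγδ : 0 < γ - δ := by nlinarith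
    obtain ⟨g', γ', hg', -, hγ', hγt, hex'⟩ := H g hg hgc (γ - δ) hγδ (by linarith)
    have hpos : 0 < γ' := (mul_pos hc' hγδ).trans_le hγ'
    refine (hopt g' hg').not_gt (CNet.kappa_lt_of_excess_eq (s := t) (t := t) (δ := 0) (γ := γ')
      le_rfl (by linarith) (by simpa using mul_pos (N.M_pos t) hpos) fun v => ?_)
    rw [hex', hex]
    split_ifs <;> ring
  · obtain ⟨c, hc, hpath⟩ := CNet.exists_canPush_of_isResWalk hf hP
    obtain ⟨η, hη, H⟩ := hpath (-N.excess f t) (by linarith)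
    obtain ⟨δ, hδ, hδ'⟩ := exists_between (lt_min hη hs)
    obtain ⟨g, γ, hg, -, hγ, hγt, hex⟩ :=
      H f hf (N.close_self f hη) δ hδ (hδ'.trans_le (min_le_left _ _))
    have hδs := hδ'.trans_le (min_le_right _ _)
    have hpos : 0 < γ := (mul_pos hc hδ).trans_le hγ
    have hst : s ≠ t := by rintro rfl; linarith
    refine (hopt g hg).not_gt (Finset.sum_lt_sum (fun v _ => ?_) ⟨t, Finset.mem_univ t, ?_⟩)
    · refine mul_le_mul_of_nonneg_left ?_ (N.M_pos v).le
      rw [hex v]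
      rcases eq_or_ne s v with rfl | hsv
      · refine max_le (le_max_of_le_right ?_) (le_max_right _ _)
        simp only [if_true, hst.symm, if_false]
        linarith
      · refine max_le_max ?_ le_rfl
        simp only [hsv, if_false]
        split_ifs <;> linarith
    · refine mul_lt_mul_of_pos_left ?_ (N.M_pos t)
      rw [hex t]
      simp only [hst, if_true, if_false]
      exact max_lt (lt_max_of_lt_left (by linarith)) (lt_max_of_lt_left (by linarith))
  · have hMs := N.M_pos s
    have hMt := N.M_pos t
    obtain ⟨c, hc, hcG⟩ := exists_between hgain
    obtain ⟨η, hη, H⟩ := CNet.canPush_of_lt_gainDeriv hf hP ((div_pos hMs hMt).trans hc) hcG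
      (-N.excess f t) (by linarith)
    obtain ⟨δ, hδ, hδη⟩ := exists_between hη
    obtain ⟨g, γ, hg, -, hγ, hγt, hex⟩ := H f hf (N.close_self f hη) δ hδ hδη
    rw [div_lt_iff₀ hMt] at hc
    refine (hopt g hg).not_gt (CNet.kappa_lt_of_excess_eq hδ.le (by linarith) ?_ hex)
    have h1 := mul_lt_mul_of_pos_right hc hδ
    have h2 := mul_le_mul_of_nonneg_left hγ hMt.le
    linarith
end

section
/- Let Γ:[0,u]→ℝ be a concave, strictly monotone increasing function, let f∈[0,u), let μ_i,μ_j>0, and let 0<Δ≤Δ' with Γ(f)+Δ'μ_j ≤ Γ(u). If Γ^{-1}(Γ(f)+Δμ_j) − f ≥ Δμ_i, then Γ^{-1}(Γ(f)+Δ'μ_j) − f ≥ Δ'μ_i. (Equivalently: in a concave generalized flow network, if an arc ij is Δ'-fat and satisfies θ^μ_Δ(ij)≤1, then θ^μ_{Δ'}(ij)≤1; hence a Δ-conservative labeling is Δ'-conservative for every Δ'≥Δ.) -/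
/-- A point where a concave strictly increasing function has climbed a fraction `t` of its rise from
`f` to `y` lies at most a fraction `t` of the way from `f` to `y`. -/
theorem ConcaveOn.sub_le_mul_sub_of_strictMonoOn {s : Set ℝ} {Γ : ℝ → ℝ} {f x y t : ℝ}
    (hconc : ConcaveOn ℝ s Γ) (hmono : StrictMonoOn Γ s) (hf : f ∈ s) (hx : x ∈ s) (hy : y ∈ s)
    (ht0 : 0 ≤ t) (ht1 : t ≤ 1) (hΓx : Γ x - Γ f ≤ t * (Γ y - Γ f)) :
    x - f ≤ t * (y - f) := by
  have hz := hconc.1 hf hy (sub_nonneg.2 ht1) ht0 (sub_add_cancel 1 t)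
  have hΓz := hconc.2 hf hy (sub_nonneg.2 ht1) ht0 (sub_add_cancel 1 t)
  have hxz : x ≤ (1 - t) • f + t • y := by
    rw [← hmono.le_iff_le hx hz]
    simp only [smul_eq_mul] at hΓz ⊢
    linarith
  simp only [smul_eq_mul] at hxz
  linarith

/-- On an interval `[0, u]`, values of a continuous function between `Γ f` and `Γ u` are attained. -/
theorem ContinuousOn.mem_image_Icc_of_le {u f v : ℝ} {Γ : ℝ → ℝ}
    (hcont : ContinuousOn Γ (Set.Icc 0 u)) (hf0 : 0 ≤ f) (hfu : f ≤ u)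
    (hfv : Γ f ≤ v) (hvu : v ≤ Γ u) : ∃ x ∈ Set.Icc 0 u, Γ x = v :=
  Set.image_mono (Set.Icc_subset_Icc_left hf0)
    (intermediate_value_Icc hfu (hcont.mono (Set.Icc_subset_Icc_left hf0)) ⟨hfv, hvu⟩)

/-- Let `Γ : [0,u] → ℝ` be concave, strictly monotone increasing (and
continuous, so that its inverse is defined on `[Γ(0), Γ(u)]`), let `f ∈ [0,u)`,
`μ_i, μ_j > 0`, and `0 < Δ ≤ Δ'` with `Γ(f) + Δ'μ_j ≤ Γ(u)`.
If `Γ⁻¹(Γ(f) + Δμ_j) − f ≥ Δμ_i`, then `Γ⁻¹(Γ(f) + Δ'μ_j) − f ≥ Δ'μ_i`.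
(Equivalently: if an arc is `Δ'`-fat and `θ^μ_Δ(ij) ≤ 1`, then `θ^μ_{Δ'}(ij) ≤ 1`; hence a
`Δ`-conservative labeling is `Δ'`-conservative for every `Δ' ≥ Δ`.) -/
theorem theta_monotone (u f Δ Δ' μi μj : ℝ) (Γ : ℝ → ℝ)
    (hconc : ConcaveOn ℝ (Set.Icc 0 u) Γ)
    (hmono : StrictMonoOn Γ (Set.Icc 0 u))
    (hcont : ContinuousOn Γ (Set.Icc 0 u))
    (hf0 : 0 ≤ f) (hfu : f < u)
    (hμi : 0 < μi) (hμj : 0 < μj)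
    (hΔ : 0 < Δ) (hΔΔ' : Δ ≤ Δ')
    (hfat : Γ f + Δ' * μj ≤ Γ u)
    (h : Δ * μi ≤ Function.invFunOn Γ (Set.Icc 0 u) (Γ f + Δ * μj) - f) :
    Δ' * μi ≤ Function.invFunOn Γ (Set.Icc 0 u) (Γ f + Δ' * μj) - f := by
  have hΔ' : 0 < Δ' := hΔ.trans_le hΔΔ'
  have hle : Δ * μj ≤ Δ' * μj := by gcongr
  have hex := hcont.mem_image_Icc_of_le (v := Γ f + Δ * μj) hf0 hfu.le
    (le_add_of_nonneg_right (by positivity)) (by linarith)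
  have hex' := hcont.mem_image_Icc_of_le (v := Γ f + Δ' * μj) hf0 hfu.le
    (le_add_of_nonneg_right (by positivity)) hfat
  have key := hconc.sub_le_mul_sub_of_strictMonoOn (t := Δ / Δ') hmono ⟨hf0, hfu.le⟩
    (Function.invFunOn_mem hex) (Function.invFunOn_mem hex') (by positivity)
    ((div_le_one hΔ').2 hΔΔ') (by
      rw [Function.invFunOn_eq hex, Function.invFunOn_eq hex']
      apply le_of_eq
      field_simp
      ring)
  have hscaled := h.trans key
  rw [div_mul_eq_mul_div, le_div_iff₀ hΔ'] at hscaled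
  refine le_of_mul_le_mul_left ?_ hΔ
  linarith
end

section
/- Let f be a pseudoflow of a concave generalized flow network and μ a Δ-conservative labeling for f. Then there exists a pseudoflow f̄ such that μ is a Δ/2-conservative labeling for f̄ and Ex^μ_{Δ/2}(f̄) ≤ Ex^μ_Δ(f) + (3/2)·m·Δ. -/
open Finset

namespace CNet

variable {V : Type*} [Fintype V] [DecidableEq V]

/-- `d_i`: the total number of incoming and outgoing arcs incident to `i`. -/
def deg (N : CNet V) (i : V) : ℕ :=
  (N.E.filter (fun a => a.1 = i)).card + (N.E.filter (fun a => a.2 = i)).card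

/-- The fatness of a residual arc: `Γ_{ij}(u_{ij}) − Γ_{ij}(f_{ij})` on forward arcs, and
the flow value of the underlying arc on backward arcs (the maximum possible flow increase
at the head when the arc is saturated). -/
noncomputable def fatness (N : CNet V) (f : V × V → ℝ) (e : (V × V) × Bool) : ℝ :=
  if e.2 then N.Γ e.1 (N.u e.1) - N.Γ e.1 (f e.1) else f e.1

/-- The relabeled fatness `s^μ_f(ij) = s_f(ij)/μ_j`. -/
noncomputable def relFat (N : CNet V) (f : V × V → ℝ) (μ : V → ℝ)
    (e : (V × V) × Bool) : ℝ :=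
  N.fatness f e / μ (resHead e)

/-- `e` is a `Δ`-fat arc: a residual arc of relabeled fatness at least `Δ`. -/
def IsDeltaFat (N : CNet V) (f : V × V → ℝ) (μ : V → ℝ) (Δ : ℝ)
    (e : (V × V) × Bool) : Prop :=
  N.IsResArc f e ∧ Δ ≤ N.relFat f μ e

/-- The linearized relabeled gain
`θ^μ_Δ(ij) = Δμ_i / (Γ_{ij}⁻¹(Γ_{ij}(f_{ij}) + Δμ_j) − f_{ij})` on forward arcs; on a
backward arc `ji` this becomes `θ^μ_Δ(ji) = Δμ_j / (Γ_{ij}(f_{ij}) − Γ_{ij}(f_{ij} − Δμ_i))`. -/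
noncomputable def theta (N : CNet V) (f : V × V → ℝ) (μ : V → ℝ) (Δ : ℝ)
    (e : (V × V) × Bool) : ℝ :=
  if e.2 then
    Δ * μ e.1.1 / (N.Γinv e.1 (N.Γ e.1 (f e.1) + Δ * μ e.1.2) - f e.1)
  else
    Δ * μ e.1.2 / (N.Γ e.1 (f e.1) - N.Γ e.1 (f e.1 - Δ * μ e.1.1))

/-- `μ` is a `Δ`-conservative labeling for `f`: labels are positive, `θ^μ_Δ(ij) ≤ 1` on
every `Δ`-fat arc, `μ_i ≥ 1/M_i` for all nodes, and `μ_i = 1/M_i` for every `Δ`-negative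
node (i.e. whenever `e^μ_i < d_i Δ`). -/
def DeltaConservative (N : CNet V) (f : V × V → ℝ) (μ : V → ℝ) (Δ : ℝ) : Prop :=
  (∀ i, 0 < μ i) ∧
  (∀ e, N.IsDeltaFat f μ Δ e → N.theta f μ Δ e ≤ 1) ∧
  (∀ i, 1 / N.M i ≤ μ i) ∧
  (∀ i, N.excess f i / μ i < (N.deg i : ℝ) * Δ → μ i = 1 / N.M i)

/-- The modified relabeled excess `Ex^μ_Δ(f) = Σ_i max{e^μ_i − d_i Δ, 0}`. -/
noncomputable def ExDelta (N : CNet V) (f : V × V → ℝ) (μ : V → ℝ) (Δ : ℝ) : ℝ :=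
  ∑ i, max (N.excess f i / μ i - (N.deg i : ℝ) * Δ) 0

end CNet

/-- One-arc adjustment: halving the step of the two discrete slope conditions (gain at most one per
forward step, at least one per backward step, in units `p` at the tail and `q` at the head) costs a
change of at most one half-step at either end. -/
theorem exists_half_step_adjustment {g : ℝ → ℝ} {u p q D x : ℝ}
    (hg : StrictMonoOn g (Set.Icc 0 u)) (hp : 0 < p) (hq : 0 < q) (hD : 0 < D)
    (hx : x ∈ Set.Icc 0 u)
    (hfwd : ∀ y ∈ Set.Icc 0 u, g y = g x + 2 * D * q → x + 2 * D * p ≤ y)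
    (hbwd : 2 * D * p ≤ x → 2 * D * q ≤ g x - g (x - 2 * D * p)) :
    ∃ x' ∈ Set.Icc 0 u,
      (∀ y ∈ Set.Icc 0 u, g y = g x' + D * q → x' + D * p ≤ y) ∧
      (D * p ≤ x' → D * q ≤ g x' - g (x' - D * p)) ∧
      x' - x ≤ D * p ∧ g x - g x' ≤ D * q ∧
      max ((g x' - g x) / q) 0 + max ((x - x') / p) 0 ≤ D := by
  have hDp : 0 < D * p := mul_pos hD hp
  have hDq : 0 < D * q := mul_pos hD hq
  by_cases h₁ : ∀ y ∈ Set.Icc 0 u, g y = g x + D * q → x + D * p ≤ y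
  · by_cases h₂ : D * p ≤ x → D * q ≤ g x - g (x - D * p)
    · refine ⟨x, hx, h₁, h₂, by linarith, by linarith, ?_⟩
      simpa using hD.le
    · push Not at h₂
      obtain ⟨hle, hlt⟩ := h₂
      have hx' : x - D * p ∈ Set.Icc 0 u := ⟨by linarith, by linarith [hx.2]⟩
      have hgx : g (x - D * p) < g x := hg hx' hx (by linarith)
      refine ⟨x - D * p, hx', fun y hy hyg => ?_, fun hle' => ?_, by linarith, by linarith, ?_⟩
      · have := (hg.lt_iff_lt hx hy).1 (by linarith)
        linarith
      · have := hbwd (by linarith)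
        rw [show x - D * p - D * p = x - 2 * D * p by ring]
        linarith
      · rw [max_eq_right (div_nonpos_of_nonpos_of_nonneg (by linarith) hq.le), sub_sub_cancel,
          mul_div_cancel_right₀ _ hp.ne', max_eq_left hD.le, zero_add]
  · push Not at h₁
    obtain ⟨y, hy, hyg, hlt⟩ := h₁
    have hxy : x < y := (hg.lt_iff_lt hx hy).1 (by linarith)
    refine ⟨y, hy, fun z hz hzg => ?_, fun hle => ?_, by linarith, by linarith, ?_⟩
    · have := hfwd z hz (by linarith)
      linarith
    · have := hg.monotoneOn (a := y - D * p) (b := x)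
        ⟨by linarith, by linarith [hy.2]⟩ hx (by linarith)
      linarith
    · rw [hyg, add_sub_cancel_left, mul_div_cancel_right₀ _ hq.ne', max_eq_left hD.le,
        max_eq_right (div_nonpos_of_nonpos_of_nonneg (by linarith) hp.le), add_zero]

namespace CNet

variable {V : Type*} [Fintype V] [DecidableEq V]

theorem Γinv_apply_eq (N : CNet V) {a : V × V} (ha : a ∈ N.E) {y c : ℝ}
    (hy : y ∈ Set.Icc 0 (N.u a)) (hc : N.Γ a y = c) : N.Γinv a c = y := by
  have hex : ∃ z ∈ Set.Icc 0 (N.u a), N.Γ a z = c := ⟨y, hy, hc⟩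
  exact (N.mono a ha).injOn (Function.invFunOn_mem hex) hy
    ((Function.invFunOn_eq hex).trans hc.symm)

/-- The conservativity condition on the forward copy of an arc, without the inverse gain. -/
theorem forward_theta_le_one_iff (N : CNet V) {f : V × V → ℝ} {μ : V → ℝ} {D : ℝ}
    (hf : N.IsPseudoflow f) (hμ : ∀ i, 0 < μ i) (hD : 0 < D) {a : V × V} (ha : a ∈ N.E) :
    (N.IsDeltaFat f μ D (a, true) → N.theta f μ D (a, true) ≤ 1) ↔
      ∀ y ∈ Set.Icc 0 (N.u a), N.Γ a y = N.Γ a (f a) + D * μ a.2 → f a + D * μ a.1 ≤ y := by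
  have hx : f a ∈ Set.Icc 0 (N.u a) := hf a ha
  have hu : N.u a ∈ Set.Icc 0 (N.u a) := ⟨N.u_nonneg a ha, le_rfl⟩
  have hDq : 0 < D * μ a.2 := mul_pos hD (hμ _)
  have htheta : ∀ y ∈ Set.Icc 0 (N.u a), N.Γ a y = N.Γ a (f a) + D * μ a.2 →
      (N.theta f μ D (a, true) ≤ 1 ↔ f a + D * μ a.1 ≤ y) := by
    intro y hy hyg
    have hlt : f a < y := ((N.mono a ha).lt_iff_lt hx hy).1 (by linarith)
    simp only [theta, if_true]
    rw [N.Γinv_apply_eq ha hy hyg, div_le_one (by linarith)]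
    constructor <;> intro h <;> linarith
  simp only [IsDeltaFat, IsResArc, relFat, fatness, resHead, if_true]
  rw [le_div_iff₀ (hμ _)]
  constructor
  · intro h y hy hyg
    have hyu := (N.mono a ha).monotoneOn hy hu hy.2
    have hlt : f a < N.u a := ((N.mono a ha).lt_iff_lt hx hu).1 (by linarith)
    exact (htheta y hy hyg).1 (h ⟨⟨ha, hlt⟩, by linarith⟩)
  · rintro h ⟨-, hfat⟩
    obtain ⟨y, hy, hyg⟩ := intermediate_value_Icc hx.2
      ((N.cont a ha).mono (Set.Icc_subset_Icc_left hx.1))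
      (show N.Γ a (f a) + D * μ a.2 ∈ Set.Icc (N.Γ a (f a)) (N.Γ a (N.u a)) from
        ⟨by linarith, by linarith⟩)
    have hy' : y ∈ Set.Icc 0 (N.u a) := ⟨hx.1.trans hy.1, hy.2⟩
    exact (htheta y hy' hyg).2 (h y hy' hyg)

/-- The conservativity condition on the backward copy of an arc, without division. -/
theorem backward_theta_le_one_iff (N : CNet V) {f : V × V → ℝ} {μ : V → ℝ} {D : ℝ}
    (hf : N.IsPseudoflow f) (hμ : ∀ i, 0 < μ i) (hD : 0 < D) {a : V × V} (ha : a ∈ N.E) :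
    (N.IsDeltaFat f μ D (a, false) → N.theta f μ D (a, false) ≤ 1) ↔
      (D * μ a.1 ≤ f a → D * μ a.2 ≤ N.Γ a (f a) - N.Γ a (f a - D * μ a.1)) := by
  have hx : f a ∈ Set.Icc 0 (N.u a) := hf a ha
  have hDp : 0 < D * μ a.1 := mul_pos hD (hμ _)
  simp only [IsDeltaFat, IsResArc, relFat, fatness, resHead, theta, Bool.false_eq_true, if_false]
  rw [le_div_iff₀ (hμ _)]
  have hiff : D * μ a.1 ≤ f a →
      (D * μ a.2 / (N.Γ a (f a) - N.Γ a (f a - D * μ a.1)) ≤ 1 ↔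
        D * μ a.2 ≤ N.Γ a (f a) - N.Γ a (f a - D * μ a.1)) := by
    intro hle
    have hmem : f a - D * μ a.1 ∈ Set.Icc 0 (N.u a) := ⟨by linarith, by linarith [hx.2]⟩
    have := N.mono a ha hmem hx (by linarith)
    exact div_le_one (by linarith)
  constructor
  · intro h hle
    exact (hiff hle).1 (h ⟨⟨ha, by linarith⟩, hle⟩)
  · rintro h ⟨-, hle⟩
    exact (hiff hle).2 (h hle)

/-- The change of the relabeled excess between two flows, arc by arc. -/
theorem excess_div_sub_excess_div (N : CNet V) (f f' : V × V → ℝ) (μ : V → ℝ) (i : V) :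
    N.excess f' i / μ i - N.excess f i / μ i =
      ∑ a ∈ N.E.filter (fun a => a.2 = i), (N.Γ a (f' a) - N.Γ a (f a)) / μ a.2 +
      ∑ a ∈ N.E.filter (fun a => a.1 = i), (f a - f' a) / μ a.1 := by
  have h₁ : ∑ a ∈ N.E.filter (fun a => a.2 = i), (N.Γ a (f' a) - N.Γ a (f a)) / μ a.2 =
      ∑ a ∈ N.E.filter (fun a => a.2 = i), (N.Γ a (f' a) - N.Γ a (f a)) / μ i :=
    sum_congr rfl fun a ha => by rw [(mem_filter.1 ha).2]
  have h₂ : ∑ a ∈ N.E.filter (fun a => a.1 = i), (f a - f' a) / μ a.1 =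
      ∑ a ∈ N.E.filter (fun a => a.1 = i), (f a - f' a) / μ i :=
    sum_congr rfl fun a ha => by rw [(mem_filter.1 ha).2]
  rw [h₁, h₂, ← sum_div, ← sum_div, sum_sub_distrib, sum_sub_distrib]
  simp only [excess]
  ring

theorem sum_deg (N : CNet V) : ∑ i, (N.deg i : ℝ) = 2 * (N.E.card : ℝ) := by
  have h₁ : N.E.card = ∑ i, (N.E.filter (fun a => a.1 = i)).card :=
    card_eq_sum_card_fiberwise fun _ _ => mem_coe.2 (mem_univ _)
  have h₂ : N.E.card = ∑ i, (N.E.filter (fun a => a.2 = i)).card :=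
    card_eq_sum_card_fiberwise fun _ _ => mem_coe.2 (mem_univ _)
  rw [← Nat.cast_sum]
  simp only [deg, sum_add_distrib]
  rw [← h₁, ← h₂]
  push_cast
  ring

/-- If every arc lowers the relabeled excess at its two ends by at most `D` each, then the relabeled
excess of a node drops by at most its degree times `D`. -/
theorem excess_div_sub_deg_mul_le (N : CNet V) {f f' : V × V → ℝ} {μ : V → ℝ} {D : ℝ}
    (hhead : ∀ a ∈ N.E, -D ≤ (N.Γ a (f' a) - N.Γ a (f a)) / μ a.2)
    (htail : ∀ a ∈ N.E, -D ≤ (f a - f' a) / μ a.1) (i : V) :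
    N.excess f i / μ i - (N.deg i : ℝ) * D ≤ N.excess f' i / μ i := by
  have h₁ := card_nsmul_le_sum (N.E.filter (fun a => a.2 = i))
    (fun a => (N.Γ a (f' a) - N.Γ a (f a)) / μ a.2) (-D)
    fun a ha => hhead a (mem_filter.1 ha).1
  have h₂ := card_nsmul_le_sum (N.E.filter (fun a => a.1 = i))
    (fun a => (f a - f' a) / μ a.1) (-D) fun a ha => htail a (mem_filter.1 ha).1
  have h₃ := N.excess_div_sub_excess_div f f' μ i
  rw [nsmul_eq_mul] at h₁ h₂
  simp only [deg, Nat.cast_add]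
  linarith

/-- If every arc raises the relabeled excess at its two ends by at most `D` in total, then halving
the scale `2 * D` raises the modified excess by at most `3 * |E| * D`. -/
theorem ExDelta_le_add (N : CNet V) {f f' : V × V → ℝ} {μ : V → ℝ} {D : ℝ} (hD : 0 ≤ D)
    (hrise : ∀ a ∈ N.E, max ((N.Γ a (f' a) - N.Γ a (f a)) / μ a.2) 0 +
      max ((f a - f' a) / μ a.1) 0 ≤ D) :
    N.ExDelta f' μ D ≤ N.ExDelta f μ (2 * D) + 3 * (N.E.card : ℝ) * D := by
  set r : V × V → ℝ := fun a => max ((N.Γ a (f' a) - N.Γ a (f a)) / μ a.2) 0 with hr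
  set s : V × V → ℝ := fun a => max ((f a - f' a) / μ a.1) 0 with hs
  have hnode : ∀ i, max (N.excess f' i / μ i - (N.deg i : ℝ) * D) 0 ≤
      max (N.excess f i / μ i - (N.deg i : ℝ) * (2 * D)) 0 + (N.deg i : ℝ) * D +
        (∑ a ∈ N.E.filter (fun a => a.2 = i), r a +
          ∑ a ∈ N.E.filter (fun a => a.1 = i), s a) := by
    intro i
    have h₁ := N.excess_div_sub_excess_div f f' μ i
    have h₂ : ∑ a ∈ N.E.filter (fun a => a.2 = i), (N.Γ a (f' a) - N.Γ a (f a)) / μ a.2 ≤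
        ∑ a ∈ N.E.filter (fun a => a.2 = i), r a := sum_le_sum fun a _ => le_max_left _ _
    have h₃ : ∑ a ∈ N.E.filter (fun a => a.1 = i), (f a - f' a) / μ a.1 ≤
        ∑ a ∈ N.E.filter (fun a => a.1 = i), s a := sum_le_sum fun a _ => le_max_left _ _
    have h₄ : 0 ≤ ∑ a ∈ N.E.filter (fun a => a.2 = i), r a :=
      sum_nonneg fun a _ => le_max_right _ _
    have h₅ : 0 ≤ ∑ a ∈ N.E.filter (fun a => a.1 = i), s a :=
      sum_nonneg fun a _ => le_max_right _ _
    have h₆ : 0 ≤ (N.deg i : ℝ) * D := by positivity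
    have h₇ := le_max_left (N.excess f i / μ i - (N.deg i : ℝ) * (2 * D)) 0
    have h₈ := le_max_right (N.excess f i / μ i - (N.deg i : ℝ) * (2 * D)) 0
    exact max_le (by linarith) (by linarith)
  have hsum := sum_le_sum fun i (_ : i ∈ univ) => hnode i
  simp only [sum_add_distrib, sum_fiberwise, ← sum_mul, N.sum_deg] at hsum
  have hE := sum_le_card_nsmul N.E (fun a => r a + s a) D hrise
  rw [nsmul_eq_mul, sum_add_distrib] at hE
  simp only [ExDelta]
  linarith

end CNet

/-- If `μ` is a `Δ`-conservative labeling for the pseudoflow `f`, then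
there is a pseudoflow `f̄` such that `μ` is `Δ/2`-conservative for `f̄` and
`Ex^μ_{Δ/2}(f̄) ≤ Ex^μ_Δ(f) + (3/2)·m·Δ`. -/
theorem delta_adjust_concave {V : Type*} [Fintype V] [DecidableEq V]
    (N : CNet V) (f : V × V → ℝ) (μ : V → ℝ) (Δ : ℝ)
    (hf : N.IsPseudoflow f) (hΔ : 0 < Δ)
    (hcons : N.DeltaConservative f μ Δ) :
    ∃ fb, N.IsPseudoflow fb ∧ N.DeltaConservative fb μ (Δ / 2) ∧
      N.ExDelta fb μ (Δ / 2) ≤ N.ExDelta f μ Δ + 3 / 2 * (N.E.card : ℝ) * Δ := by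
  obtain ⟨hμ, hθ, hM, hneg⟩ := hcons
  obtain ⟨D, rfl⟩ : ∃ D, Δ = 2 * D := ⟨Δ / 2, by ring⟩
  have hD : 0 < D := by linarith
  rw [mul_div_cancel_left₀ D two_ne_zero]
  have harc : ∀ a, ∃ x', a ∈ N.E → x' ∈ Set.Icc 0 (N.u a) ∧
      (∀ y ∈ Set.Icc 0 (N.u a), N.Γ a y = N.Γ a x' + D * μ a.2 → x' + D * μ a.1 ≤ y) ∧
      (D * μ a.1 ≤ x' → D * μ a.2 ≤ N.Γ a x' - N.Γ a (x' - D * μ a.1)) ∧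
      x' - f a ≤ D * μ a.1 ∧ N.Γ a (f a) - N.Γ a x' ≤ D * μ a.2 ∧
      max ((N.Γ a x' - N.Γ a (f a)) / μ a.2) 0 + max ((f a - x') / μ a.1) 0 ≤ D := by
    intro a
    by_cases ha : a ∈ N.E
    · obtain ⟨x', hx'⟩ := exists_half_step_adjustment (N.mono a ha) (hμ a.1) (hμ a.2) hD (hf a ha)
        ((N.forward_theta_le_one_iff hf hμ hΔ ha).1 (hθ _))
        ((N.backward_theta_le_one_iff hf hμ hΔ ha).1 (hθ _))
      exact ⟨x', fun _ => hx'⟩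
    · exact ⟨0, fun h => absurd h ha⟩
  choose fb hfb using harc
  have hpf : N.IsPseudoflow fb := fun a ha => (hfb a ha).1
  refine ⟨fb, hpf, ⟨hμ, ?_, hM, fun i hi => hneg i ?_⟩, ?_⟩
  · rintro ⟨a, _ | _⟩ hfat
    · have ha : a ∈ N.E := hfat.1.1
      exact (N.backward_theta_le_one_iff hpf hμ hD ha).2 (hfb a ha).2.2.1 hfat
    · have ha : a ∈ N.E := hfat.1.1
      exact (N.forward_theta_le_one_iff hpf hμ hD ha).2 (hfb a ha).2.1 hfat
  · have := N.excess_div_sub_deg_mul_le (f := f) (f' := fb) (μ := μ) (D := D)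
      (fun a ha => by
        rw [le_div_iff₀ (hμ _)]
        linarith [(hfb a ha).2.2.2.2.1])
      (fun a ha => by
        rw [le_div_iff₀ (hμ _)]
        linarith [(hfb a ha).2.2.2.1]) i
    linarith
  · have := N.ExDelta_le_add (f := f) (f' := fb) (μ := μ) hD.le
      fun a ha => (hfb a ha).2.2.2.2.2
    linarith
end

section
/- Consider the nonsymmetric Arrow-Debreu Nash bargaining program with integer utilities U_{ij} (maximum value U_max), positive integer budgets m_i ≤ R, and integer disagreement utilities c_i ≥ 0, and let n=|B|+|G|. If the program is feasible and has a unique optimal allocation x*, then all positive entries x*_{ij} are rational numbers admitting a common denominator S with S ≤ (n·R·U_max)^n. -/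
open Finset

variable {B G : Type*} [Fintype B] [Fintype G]

/-- An allocation of the goods: `x ≥ 0` and each good is allocated at most once. -/
def IsAllocation (x : B → G → ℝ) : Prop :=
  (∀ i j, 0 ≤ x i j) ∧ ∀ j, ∑ i, x i j ≤ 1

/-- The surplus utility `Σ_j U_{ij} x_{ij} − c_i` of buyer `i`. -/
noncomputable def surplus (U : B → G → ℕ) (c : B → ℕ) (x : B → G → ℝ) (i : B) : ℝ :=
  ∑ j, (U i j : ℝ) * x i j - (c i : ℝ)

/-- A feasible point of the nonsymmetric ADNB program. -/
def IsFeasibleADNB (U : B → G → ℕ) (c : B → ℕ) (x : B → G → ℝ) : Prop :=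
  IsAllocation x ∧ ∀ i, 0 < surplus U c x i

/-- The objective `Σ_i m_i · log(Σ_j U_{ij} x_{ij} − c_i)`. -/
noncomputable def objADNB (U : B → G → ℕ) (m : B → ℕ) (c : B → ℕ) (x : B → G → ℝ) : ℝ :=
  ∑ i, (m i : ℝ) * Real.log (surplus U c x i)

/-- An optimal solution of the nonsymmetric ADNB program. -/
def IsOptimalADNB (U : B → G → ℕ) (m : B → ℕ) (c : B → ℕ) (x : B → G → ℝ) : Prop :=
  IsFeasibleADNB U c x ∧
  ∀ y, IsFeasibleADNB U c y → objADNB U m c y ≤ objADNB U m c x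

/-- The bipartite graph on `α ⊕ β` whose edges join `i` and `j` whenever `s i j`. -/
def bipGraph {α β : Type*} (s : α → β → Prop) : SimpleGraph (α ⊕ β) :=
  SimpleGraph.fromRel fun u v => ∃ i j, s i j ∧ u = Sum.inl i ∧ v = Sum.inr j

lemma bipGraph_adj {α β : Type*} {s : α → β → Prop} {u v : α ⊕ β} :
    (bipGraph s).Adj u v ↔ (∃ i j, s i j ∧ u = Sum.inl i ∧ v = Sum.inr j) ∨
      ∃ i j, s i j ∧ v = Sum.inl i ∧ u = Sum.inr j := by
  simp only [bipGraph, SimpleGraph.fromRel_adj, and_iff_right_iff_imp]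
  rintro (⟨i, j, -, rfl, rfl⟩ | ⟨i, j, -, rfl, rfl⟩) <;> simp

lemma bipGraph_adj_inl_inr {α β : Type*} {s : α → β → Prop} {i : α} {j : β} (h : s i j) :
    (bipGraph s).Adj (Sum.inl i) (Sum.inr j) :=
  bipGraph_adj.2 (Or.inl ⟨i, j, h, rfl, rfl⟩)

/-- A walk from `u` to `v` carries a unit flow from `u` to `v`. -/
lemma exists_unit_flow {α β : Type*} [Fintype α] [Fintype β] [DecidableEq α] [DecidableEq β]
    {s : α → β → Prop} {u v : α ⊕ β} (w : (bipGraph s).Walk u v) :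
    ∃ f : α → β → ℝ, (∀ i j, ¬ s i j → f i j = 0) ∧
      (∀ i, ∑ j, f i j = (if u = Sum.inl i then 1 else 0) - (if v = Sum.inl i then 1 else 0)) ∧
      ∀ j, ∑ i, f i j = (if v = Sum.inr j then 1 else 0) - (if u = Sum.inr j then 1 else 0) := by
  induction w with
  | nil => exact ⟨0, by simp⟩
  | @cons u u' v h p ih =>
    obtain ⟨f, hf, hl, hr⟩ := ih
    rcases bipGraph_adj.1 h with ⟨a, b, hab, rfl, rfl⟩ | ⟨a, b, hab, rfl, rfl⟩
    · refine ⟨fun i j => f i j + if a = i ∧ b = j then 1 else 0, ?_, ?_, ?_⟩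
      · intro i j hij
        have : ¬ (a = i ∧ b = j) := by rintro ⟨rfl, rfl⟩; exact hij hab
        simp [hf i j hij, this]
      · intro i
        simp only [sum_add_distrib, hl, ite_and]
        by_cases hi : a = i <;> simp [hi]
        ring
      · intro j
        simp only [sum_add_distrib, hr, and_comm (b := b = j), ite_and]
        by_cases hj : b = j <;> simp [hj]
    · refine ⟨fun i j => f i j - if a = i ∧ b = j then 1 else 0, ?_, ?_, ?_⟩
      · intro i j hij
        have : ¬ (a = i ∧ b = j) := by rintro ⟨rfl, rfl⟩; exact hij hab
        simp [hf i j hij, this]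
      · intro i
        simp only [sum_sub_distrib, hl, ite_and]
        by_cases hi : a = i <;> simp [hi]
      · intro j
        simp only [sum_sub_distrib, hr, and_comm (b := b = j), ite_and]
        by_cases hj : b = j <;> simp [hj]

/-- Vertex values that scale by `U i j` across each edge are related along a path by a ratio
whose denominator divides the product of the edge weights on the path. -/
lemma exists_prod_mul_eq_of_isPath {α β : Type*} [DecidableEq α] [DecidableEq β]
    {s : α → β → Prop} {U : α → β → ℕ} {val : α ⊕ β → ℝ}
    (hval : ∀ i j, s i j → val (Sum.inr j) = U i j * val (Sum.inl i))
    {u v : α ⊕ β} (w : (bipGraph s).Walk u v) (hw : w.IsPath) :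
    ∃ F : Finset (α × β), (∀ e ∈ F, s e.1 e.2 ∧ Sum.inl e.1 ∈ w.support ∧
      Sum.inr e.2 ∈ w.support) ∧ ∃ k : ℕ, ((∏ e ∈ F, U e.1 e.2 : ℕ) : ℝ) * val v = k * val u := by
  induction w with
  | nil => exact ⟨∅, by simp, 1, by simp⟩
  | @cons u u' v h p ih =>
    rw [SimpleGraph.Walk.cons_isPath_iff] at hw
    obtain ⟨F, hF, k, hk⟩ := ih hw.1
    rcases bipGraph_adj.1 h with ⟨a, b, hab, rfl, rfl⟩ | ⟨a, b, hab, rfl, rfl⟩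
    · have hnot : (a, b) ∉ F := fun hm => hw.2 (hF _ hm).2.1
      refine ⟨insert (a, b) F, ?_, U a b * U a b * k, ?_⟩
      · intro e he
        rcases mem_insert.1 he with rfl | he
        · simp [hab]
        · have := hF e he
          simp [this]
      · rw [prod_insert hnot]
        push_cast at hk ⊢
        rw [mul_assoc, hk, hval a b hab]
        ring
    · have hnot : (a, b) ∉ F := fun hm => hw.2 (hF _ hm).2.2
      refine ⟨insert (a, b) F, ?_, k, ?_⟩
      · intro e he
        rcases mem_insert.1 he with rfl | he
        · simp [hab]
        · have := hF e he
          simp [this]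
      · rw [prod_insert hnot]
        push_cast at hk ⊢
        rw [mul_assoc, hk, hval a b hab]
        ring

lemma surplus_add_smul {α β : Type*} [Fintype β] (U : α → β → ℕ) (c : α → ℕ)
    (x d : α → β → ℝ) (t : ℝ) (i : α) :
    surplus U c (fun i j => x i j + t * d i j) i =
      surplus U c x i + t * ∑ j, (U i j : ℝ) * d i j := by
  simp only [surplus, mul_add, sum_add_distrib, mul_sum]
  have : ∀ j, (U i j : ℝ) * (t * d i j) = t * (U i j * d i j) := fun j => by ring
  simp only [this]
  ring

/-- First-order optimality condition along a feasible direction. -/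
lemma IsOptimalADNB.sum_div_surplus_mul_nonpos {U : B → G → ℕ} {m c : B → ℕ} {x d : B → G → ℝ}
    (h : IsOptimalADNB U m c x) {ε : ℝ} (hε : 0 < ε)
    (hd : ∀ t, 0 < t → t < ε → IsAllocation fun i j => x i j + t * d i j) :
    ∑ i, (m i / surplus U c x i) * ∑ j, (U i j : ℝ) * d i j ≤ 0 := by
  set δ : B → ℝ := fun i => ∑ j, (U i j : ℝ) * d i j
  set σ : B → ℝ := surplus U c x
  have hpos : ∀ i, 0 < σ i := h.1.2
  have hlim : ∀ i, Filter.Tendsto (fun t : ℝ => σ i + t * δ i) (nhdsWithin 0 (Set.Ioi 0))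
      (nhds (σ i)) := by
    intro i
    have : Filter.Tendsto (fun t : ℝ => σ i + t * δ i) (nhds 0) (nhds (σ i + 0 * δ i)) :=
      (by fun_prop : Continuous fun t : ℝ => σ i + t * δ i).tendsto 0
    rw [zero_mul, add_zero] at this
    exact this.mono_left nhdsWithin_le_nhds
  have hT : Filter.Tendsto (fun t : ℝ => ∑ i, (m i / (σ i + t * δ i)) * δ i)
      (nhdsWithin 0 (Set.Ioi 0)) (nhds (∑ i, (m i / σ i) * δ i)) :=
    tendsto_finsetSum _ fun i _ =>
      ((tendsto_const_nhds.div (hlim i) (hpos i).ne').mul tendsto_const_nhds)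
  refine le_of_tendsto hT ?_
  have hev : ∀ᶠ t in nhdsWithin (0 : ℝ) (Set.Ioi 0), ∀ i, 0 < σ i + t * δ i :=
    Filter.eventually_all.2 fun i => (hlim i).eventually (lt_mem_nhds (hpos i))
  have hεev : ∀ᶠ t in nhdsWithin (0 : ℝ) (Set.Ioi 0), t < ε :=
    nhdsWithin_le_nhds (gt_mem_nhds hε)
  filter_upwards [hev, hεev, self_mem_nhdsWithin] with t ht htε ht0
  have ht0 : 0 < t := ht0
  have hobj := h.2 (fun i j => x i j + t * d i j)
    ⟨hd t ht0 htε, fun i => by rw [surplus_add_smul]; exact ht i⟩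
  simp only [objADNB, surplus_add_smul] at hobj
  have hle : t * ∑ i, (m i / (σ i + t * δ i)) * δ i ≤
      ∑ i, (m i : ℝ) * Real.log (σ i + t * δ i) - ∑ i, (m i : ℝ) * Real.log (σ i) := by
    rw [mul_sum, ← sum_sub_distrib]
    refine sum_le_sum fun i _ => ?_
    have h1 := Real.log_le_sub_one_of_pos (div_pos (hpos i) (ht i))
    rw [Real.log_div (hpos i).ne' (ht i).ne'] at h1
    have h2 : t * (m i / (σ i + t * δ i) * δ i) = m i * (1 - σ i / (σ i + t * δ i)) := by
      have := (ht i).ne'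
      field_simp
      ring
    rw [h2, ← mul_sub]
    exact mul_le_mul_of_nonneg_left (by linarith) (Nat.cast_nonneg _)
  have : t * ∑ i, (m i / (σ i + t * δ i)) * δ i ≤ 0 := hle.trans (by linarith)
  exact nonpos_of_mul_nonpos_right this ht0

/-- At an optimum every good is completely sold. -/
lemma IsOptimalADNB.sum_eq_one {U : B → G → ℕ} {m c : B → ℕ} {x : B → G → ℝ}
    (h : IsOptimalADNB U m c x) (hm : ∀ i, 0 < m i) {j : G} (hj : ∃ i, 0 < U i j) :
    ∑ i, x i j = 1 := by
  classical
  by_contra hne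
  have hlt : ∑ i, x i j < 1 := lt_of_le_of_ne (h.1.1.2 j) hne
  obtain ⟨k, hk⟩ := hj
  have := h.sum_div_surplus_mul_nonpos (d := fun a b => if a = k ∧ b = j then 1 else 0)
    (ε := 1 - ∑ i, x i j) (by linarith) (by
      intro t ht0 ht
      refine ⟨fun a b => ?_, fun b => ?_⟩
      · have := h.1.1.1 a b
        dsimp only
        split_ifs <;> linarith
      · have := h.1.1.2 b
        simp only [sum_add_distrib, ← mul_sum, and_comm (b := b = j), ite_and]
        by_cases hb : b = j
        · subst hb
          simp
          linarith
        · simpa [hb] using this)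
  simp only [ite_and, mul_ite, mul_one, mul_zero] at this
  have h2 : ∀ a, (∑ b, if a = k then if b = j then (U a b : ℝ) else 0 else 0) =
      if a = k then (U a j : ℝ) else 0 := by
    intro a
    by_cases ha : a = k <;> simp [ha]
  simp only [h2, mul_ite, mul_zero, sum_ite_eq', mem_univ, if_true] at this
  have h3 : 0 < (m k : ℝ) / surplus U c x k * U k j :=
    mul_pos (div_pos (by exact_mod_cast hm k) (h.1.2 k)) (by exact_mod_cast hk)
  linarith

/-- At an optimum every good goes to buyers with the largest weighted utility for it. -/
lemma IsOptimalADNB.div_surplus_mul_le {U : B → G → ℕ} {m c : B → ℕ} {x : B → G → ℝ}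
    (h : IsOptimalADNB U m c x) {i : B} {j : G} (hx : 0 < x i j) (k : B) :
    m k / surplus U c x k * U k j ≤ m i / surplus U c x i * U i j := by
  classical
  have := h.sum_div_surplus_mul_nonpos
    (d := fun a b => (if a = k then if b = j then 1 else 0 else 0) -
      (if a = i then if b = j then 1 else 0 else 0)) hx (by
      intro t ht0 ht
      refine ⟨fun a b => ?_, fun b => ?_⟩
      · have := h.1.1.1 a b
        dsimp only
        split_ifs with h1 h2 h3 h4 h5
        all_goals first | linarith | (subst_vars; linarith)
      · have := h.1.1.2 b
        simp only [sum_add_distrib, ← mul_sum, sum_sub_distrib]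
        simpa using this)
  have h2 : ∀ a, ∑ b, (U a b : ℝ) * ((if a = k then if b = j then 1 else 0 else 0) -
      (if a = i then if b = j then 1 else 0 else 0)) =
      (if a = k then (U a j : ℝ) else 0) - if a = i then (U a j : ℝ) else 0 := by
    intro a
    simp only [mul_sub, sum_sub_distrib]
    congr 1
    · by_cases ha : a = k <;> simp [ha]
    · by_cases ha : a = i <;> simp [ha]
  simp only [h2] at this
  simp only [mul_sub, sum_sub_distrib, mul_ite, mul_zero, sum_ite_eq', mem_univ,
    if_true] at this
  linarith

/-- Equilibrium prices: the weighted utility is constant and positive on the buyers of a good. -/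
lemma IsOptimalADNB.exists_price {U : B → G → ℕ} {m c : B → ℕ} {x : B → G → ℝ}
    (h : IsOptimalADNB U m c x) (hm : ∀ i, 0 < m i) {j : G} (hj : ∃ i, 0 < U i j) :
    ∃ p : ℝ, 0 < p ∧ ∀ i, 0 < x i j → p = U i j * (m i / surplus U c x i) := by
  have hsum := h.sum_eq_one hm hj
  obtain ⟨i, -, hi⟩ : ∃ i ∈ univ, 0 < x i j :=
    exists_lt_of_sum_lt (s := univ) (f := fun _ => (0 : ℝ)) (by simp [hsum])
  obtain ⟨k, hk⟩ := hj
  refine ⟨U i j * (m i / surplus U c x i), ?_, fun a ha => ?_⟩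
  · have h3 : 0 < (m k : ℝ) / surplus U c x k * U k j :=
      mul_pos (div_pos (by exact_mod_cast hm k) (h.1.2 k)) (by exact_mod_cast hk)
    have := h.div_surplus_mul_le hi k
    linarith
  · have h1 := h.div_surplus_mul_le hi a
    have h2 := h.div_surplus_mul_le ha i
    linarith

/-- A unique optimum admits no nonzero perturbation on its support that preserves all utilities
and all quantities sold. -/
lemma IsOptimalADNB.eq_zero_of_unique {U : B → G → ℕ} {m c : B → ℕ} {x : B → G → ℝ}
    (h : IsOptimalADNB U m c x) (huniq : ∀ y, IsOptimalADNB U m c y → y = x)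
    {y : B → G → ℝ} (hsupp : ∀ i j, ¬ 0 < x i j → y i j = 0)
    (hB : ∀ i, ∑ j, (U i j : ℝ) * y i j = 0) (hG : ∀ j, ∑ i, y i j = 0) (i : B) (j : G) :
    y i j = 0 := by
  have hlim : ∀ a b, Filter.Tendsto (fun t : ℝ => x a b + t * y a b)
      (nhdsWithin 0 (Set.Ioi 0)) (nhds (x a b)) := by
    intro a b
    have : Filter.Tendsto (fun t : ℝ => x a b + t * y a b) (nhds 0)
        (nhds (x a b + 0 * y a b)) :=
      (by fun_prop : Continuous fun t : ℝ => x a b + t * y a b).tendsto 0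
    rw [zero_mul, add_zero] at this
    exact this.mono_left nhdsWithin_le_nhds
  have hev : ∀ᶠ t in nhdsWithin (0 : ℝ) (Set.Ioi 0), ∀ a b, 0 ≤ x a b + t * y a b := by
    refine Filter.eventually_all.2 fun a => Filter.eventually_all.2 fun b => ?_
    by_cases hx : 0 < x a b
    · exact ((hlim a b).eventually (lt_mem_nhds hx)).mono fun t ht => ht.le
    · simp [hsupp a b hx, h.1.1.1 a b]
  obtain ⟨t, ht, ht0⟩ := (hev.and self_mem_nhdsWithin).exists
  have ht0 : 0 < t := ht0
  have hs : surplus U c (fun a b => x a b + t * y a b) = surplus U c x := by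
    funext a
    rw [surplus_add_smul, hB, mul_zero, add_zero]
  have hopt : IsOptimalADNB U m c fun a b => x a b + t * y a b := by
    refine ⟨⟨⟨ht, fun b => ?_⟩, fun a => hs ▸ h.1.2 a⟩, fun z hz => ?_⟩
    · rw [sum_add_distrib, ← mul_sum, hG, mul_zero, add_zero]
      exact h.1.1.2 b
    · have := h.2 z hz
      simpa only [objADNB, hs] using this
  have := congrFun (congrFun (huniq _ hopt) i) j
  simpa [ht0.ne'] using this

/-- The support of a unique optimum has at most `|B| + |G|` entries. -/
lemma IsOptimalADNB.card_support_le {U : B → G → ℕ} {m c : B → ℕ} {x : B → G → ℝ}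
    (h : IsOptimalADNB U m c x) (huniq : ∀ y, IsOptimalADNB U m c y → y = x) :
    #{e : B × G | 0 < x e.1 e.2} ≤ Fintype.card B + Fintype.card G := by
  classical
  let E := {e : B × G // 0 < x e.1 e.2}
  let ext : (E → ℝ) →ₗ[ℝ] B → G → ℝ :=
    { toFun := fun y a b => if hab : 0 < x a b then y ⟨(a, b), hab⟩ else 0
      map_add' := fun y z => by ext a b; by_cases hab : 0 < x a b <;> simp [hab]
      map_smul' := fun r y => by ext a b; by_cases hab : 0 < x a b <;> simp [hab] }
  let L : (E → ℝ) →ₗ[ℝ] (B ⊕ G → ℝ) :=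
    { toFun := fun y => Sum.elim (fun a => ∑ b, (U a b : ℝ) * ext y a b)
        fun b => ∑ a, ext y a b
      map_add' := fun y z => by
        ext (a | b) <;> simp [mul_add, sum_add_distrib]
      map_smul' := fun r y => by
        ext (a | b) <;> simp [mul_sum, mul_left_comm _ r] }
  have hL : Function.Injective L := by
    refine (injective_iff_map_eq_zero L).2 fun y hy => ?_
    funext ⟨⟨a, b⟩, hab⟩
    have := h.eq_zero_of_unique huniq (y := ext y)
      (fun i j hij => by simp [ext, hij])
      (fun i => congrFun hy (Sum.inl i)) (fun j => congrFun hy (Sum.inr j)) a b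
    simpa [ext, hab] using this
  have := LinearMap.finrank_le_finrank_of_injective hL
  rw [Module.finrank_fintype_fun_eq_card, Module.finrank_fintype_fun_eq_card,
    Fintype.card_sum, Fintype.card_subtype] at this
  exact this

/-- Every edge in the support of a unique optimum is a bridge of the support graph. -/
lemma IsOptimalADNB.not_reachable_of_unique {U : B → G → ℕ} {m c : B → ℕ} {x : B → G → ℝ}
    (h : IsOptimalADNB U m c x) (huniq : ∀ y, IsOptimalADNB U m c y → y = x)
    {γ : B → ℝ} {p : G → ℝ} (hγ : ∀ i, 0 < γ i) (hp : ∀ j, 0 < p j)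
    (hpγ : ∀ i j, 0 < x i j → p j = U i j * γ i) {i : B} {j : G} (hij : 0 < x i j) :
    ¬ (bipGraph fun a b => 0 < x a b ∧ ¬ (a = i ∧ b = j)).Reachable (Sum.inr j) (Sum.inl i) := by
  classical
  rintro ⟨w⟩
  obtain ⟨f, hf, hl, hr⟩ := exists_unit_flow w
  let g : B → G → ℝ := fun a b => f a b + if i = a ∧ j = b then 1 else 0
  have hg0 : ∀ a b, ¬ 0 < x a b → g a b = 0 := by
    intro a b hab
    have h1 : ¬ (i = a ∧ j = b) := by rintro ⟨rfl, rfl⟩; exact hab hij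
    simp [g, hf a b (fun h => hab h.1), h1]
  have hgB : ∀ a, ∑ b, g a b = 0 := by
    intro a
    simp only [g, sum_add_distrib, hl, ite_and]
    by_cases ha : i = a <;> simp [ha]
  have hgG : ∀ b, ∑ a, g a b = 0 := by
    intro b
    simp only [g, sum_add_distrib, hr, ite_and]
    by_cases hb : j = b <;> simp [hb]
  have := h.eq_zero_of_unique huniq (y := fun a b => g a b / p b)
    (fun a b hab => by simp [hg0 a b hab])
    (fun a => by
      have : ∀ b, (U a b : ℝ) * (g a b / p b) = g a b / γ a := by
        intro b
        by_cases hab : 0 < x a b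
        · have h1 := (hp b).ne'
          have h2 := (hγ a).ne'
          rw [mul_div_assoc', div_eq_div_iff h1 h2, hpγ a b hab]
          ring
        · simp [hg0 a b hab]
      simp only [this, ← sum_div, hgB, zero_div])
    (fun b => by simp only [← sum_div, hgG, zero_div]) i j
  have h1 : f i j = 0 := hf i j (by simp)
  simp [g, h1, (hp j).ne'] at this

/-- The flow of money into a set of vertices. -/
lemma sum_cut {x : B → G → ℝ} {p : G → ℝ} {q : B → ℝ} (hG : ∀ j, ∑ i, x i j = 1)
    (hB : ∀ i, ∑ j, p j * x i j = q i) (A : B ⊕ G → Prop) [DecidablePred A] :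
    ∑ j with A (Sum.inr j), p j - ∑ i with A (Sum.inl i), q i =
      ∑ i, ∑ j, p j * x i j *
        ((if A (Sum.inr j) then 1 else 0) - if A (Sum.inl i) then 1 else 0) := by
  have h1 : ∑ j with A (Sum.inr j), p j =
      ∑ i, ∑ j, p j * x i j * (if A (Sum.inr j) then 1 else 0) := by
    rw [sum_comm, sum_filter]
    refine sum_congr rfl fun j _ => ?_
    rw [← sum_mul, ← mul_sum, hG]
    simp
  have h2 : ∑ i with A (Sum.inl i), q i =
      ∑ i, ∑ j, p j * x i j * (if A (Sum.inl i) then 1 else 0) := by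
    rw [sum_filter]
    refine sum_congr rfl fun i _ => ?_
    rw [← sum_mul, hB]
    simp
  rw [h1, h2, ← sum_sub_distrib]
  refine sum_congr rfl fun i _ => ?_
  rw [← sum_sub_distrib]
  exact sum_congr rfl fun j _ => by ring

/-- Each entry of the allocation on a bridge has denominator dividing the product of the utilities
on the support times the total budget of its connected component. -/
lemma exists_int_component_mul {U : B → G → ℕ} {m c : B → ℕ} {x : B → G → ℝ}
    {γ : B → ℝ} {p : G → ℝ} (hx : ∀ i j, 0 ≤ x i j) (hp : ∀ j, 0 < p j)
    (hpγ : ∀ i j, 0 < x i j → p j = U i j * γ i)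
    (hG : ∀ j, ∑ i, x i j = 1) (hB : ∀ i, ∑ j, p j * x i j = m i + γ i * c i)
    {i : B} {j : G} (hbridge : ¬ (bipGraph fun a b => 0 < x a b ∧ ¬ (a = i ∧ b = j)).Reachable
      (Sum.inr j) (Sum.inl i))
    (T : B ⊕ G → Prop) [DecidablePred T]
    (hT : ∀ v, T v ↔ (bipGraph fun a b => 0 < x a b).Reachable (Sum.inr j) v) :
    ∃ z : ℤ, ((∏ e : B × G with 0 < x e.1 e.2, U e.1 e.2 : ℕ) : ℝ) *
      ((∑ a with T (Sum.inl a), m a : ℕ) : ℝ) * x i j = z := by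
  classical
  set H := bipGraph fun a b => 0 < x a b ∧ ¬ (a = i ∧ b = j)
  set K := bipGraph fun a b => 0 < x a b
  set D : ℕ := ∏ e : B × G with 0 < x e.1 e.2, U e.1 e.2
  have hx0 : ∀ a b, ¬ 0 < x a b → x a b = 0 := fun a b h => le_antisymm (not_lt.1 h) (hx a b)
  -- values on the component are integer multiples of `p j / D`
  have hval : ∀ v, T v → ∃ k : ℤ, (D : ℝ) * Sum.elim γ p v = k * p j := by
    intro v hv
    obtain ⟨w⟩ := (hT v).1 hv
    obtain ⟨F, hF, k, hk⟩ := exists_prod_mul_eq_of_isPath (U := U) (val := Sum.elim γ p)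
      hpγ w.toPath.1 w.toPath.2
    obtain ⟨r, hr⟩ : (∏ e ∈ F, U e.1 e.2) ∣ D :=
      prod_dvd_prod_of_subset _ _ _ fun e he => by simpa using (hF e he).1
    refine ⟨r * k, ?_⟩
    rw [hr, Nat.cast_mul, mul_right_comm, hk]
    push_cast
    simp only [Sum.elim_inr]
    ring
  have hval' : ∀ v, ∃ k : ℤ, T v → (D : ℝ) * Sum.elim γ p v = k * p j := fun v => by
    by_cases hv : T v
    · obtain ⟨k, hk⟩ := hval v hv
      exact ⟨k, fun _ => hk⟩
    · exact ⟨0, fun h => absurd h hv⟩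
  choose κ hκ using hval'
  have hmul : ∀ (A : B ⊕ G → Prop) [DecidablePred A], (∀ v, A v → T v) → ∃ z : ℤ,
      (D : ℝ) * (∑ b with A (Sum.inr b), p b - ∑ a with A (Sum.inl a), γ a * c a) =
      z * p j := by
    intro A _ hA
    refine ⟨∑ b with A (Sum.inr b), κ (Sum.inr b) -
      ∑ a with A (Sum.inl a), κ (Sum.inl a) * c a, ?_⟩
    push_cast
    rw [mul_sub, sub_mul, mul_sum, mul_sum, sum_mul, sum_mul]
    congr 1
    · refine sum_congr rfl fun b hb => hκ _ (hA _ (mem_filter.1 hb).2)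
    · refine sum_congr rfl fun a ha => ?_
      have := hκ _ (hA _ (mem_filter.1 ha).2)
      simp only [Sum.elim_inl] at this
      rw [← mul_assoc, this]
      ring
  let A : B ⊕ G → Prop := fun v => H.Reachable (Sum.inr j) v
  have : DecidablePred A := Classical.decPred A
  have hHK : H ≤ K := by
    intro u v huv
    rcases bipGraph_adj.1 huv with ⟨a, b, hab, rfl, rfl⟩ | ⟨a, b, hab, rfl, rfl⟩
    · exact bipGraph_adj_inl_inr hab.1
    · exact (bipGraph_adj_inl_inr (s := fun a b => 0 < x a b) hab.1).symm
  have hAT : ∀ v, A v → T v := fun v hv => (hT v).2 (hv.mono hHK)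
  have hcutT := sum_cut hG hB T
  have hcutA := sum_cut hG hB A
  have hTzero : ∑ a, ∑ b, p b * x a b *
      ((if T (Sum.inr b) then 1 else 0) - if T (Sum.inl a) then 1 else 0) = (0 : ℝ) := by
    refine sum_eq_zero fun a _ => sum_eq_zero fun b _ => ?_
    by_cases hab : 0 < x a b
    · have hadj : K.Adj (Sum.inl a) (Sum.inr b) := bipGraph_adj_inl_inr hab
      have : T (Sum.inr b) ↔ T (Sum.inl a) := by
        rw [hT, hT]
        exact ⟨fun h => h.trans hadj.symm.reachable, fun h => h.trans hadj.reachable⟩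
      simp [this]
    · simp [hx0 a b hab]
  have hAedge : ∑ a, ∑ b, p b * x a b *
      ((if A (Sum.inr b) then 1 else 0) - if A (Sum.inl a) then 1 else 0) = p j * x i j := by
    have hA1 : A (Sum.inr j) := SimpleGraph.Reachable.refl _
    have hA2 : ¬ A (Sum.inl i) := hbridge
    have hzero : ∀ a b, ¬ (a = i ∧ b = j) → p b * x a b *
        ((if A (Sum.inr b) then 1 else 0) - if A (Sum.inl a) then 1 else 0) = (0 : ℝ) := by
      intro a b hne
      by_cases hab : 0 < x a b
      · have hadj : H.Adj (Sum.inl a) (Sum.inr b) := bipGraph_adj_inl_inr ⟨hab, hne⟩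
        have : A (Sum.inr b) ↔ A (Sum.inl a) :=
          ⟨fun h => h.trans hadj.symm.reachable, fun h => h.trans hadj.reachable⟩
        simp [this]
      · simp [hx0 a b hab]
    rw [sum_eq_single i (fun a _ ha => sum_eq_zero fun b _ => hzero a b fun h => ha h.1)
      (by simp), sum_eq_single j (fun b _ hb => hzero i b fun h => hb h.2) (by simp)]
    simp [hA1, hA2]
  rw [hTzero, sum_add_distrib] at hcutT
  rw [hAedge, sum_add_distrib] at hcutA
  obtain ⟨zT, hiT⟩ := hmul T fun _ h => h
  obtain ⟨zA, hiA⟩ := hmul A hAT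
  refine ⟨(∑ a with T (Sum.inl a), m a : ℕ) * zA - (∑ a with A (Sum.inl a), m a : ℕ) * zT, ?_⟩
  refine mul_right_cancel₀ (hp j).ne' ?_
  push_cast
  set MT : ℝ := ∑ a with T (Sum.inl a), (m a : ℝ)
  set MA : ℝ := ∑ a with A (Sum.inl a), (m a : ℝ)
  linear_combination (-(D : ℝ) * MT) * hcutA + MT * hiA - MA * hiT + (D : ℝ) * MA * hcutT

/-- Consider the nonsymmetric ADNB program with integer utilities
`U_{ij} ≤ U_max`, positive integer budgets `m_i ≤ R` and integer disagreement utilities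
`c_i`, where `n = |B| + |G|`. If the program is feasible and has a unique optimal
allocation `x*`, then all positive entries of `x*` are rationals with a common
denominator `S ≤ (n·R·U_max)^n`. -/
theorem adnb_rational_optimum
    (U : B → G → ℕ) (m : B → ℕ) (c : B → ℕ) (R Umax : ℕ)
    (hm : ∀ i, 0 < m i) (hmR : ∀ i, m i ≤ R) (hU : ∀ i j, U i j ≤ Umax)
    (hbuyer : ∀ i : B, ∃ j, 0 < U i j) (hgood : ∀ j : G, ∃ i, 0 < U i j)
    (x : B → G → ℝ)
    (hopt : IsOptimalADNB U m c x)
    (huniq : ∀ y, IsOptimalADNB U m c y → y = x) :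
    ∃ S : ℕ, 0 < S ∧
      S ≤ ((Fintype.card B + Fintype.card G) * R * Umax) ^
            (Fintype.card B + Fintype.card G) ∧
      ∀ i j, 0 < x i j → ∃ k : ℕ, x i j = (k : ℝ) / (S : ℝ) := by
  classical
  rcases isEmpty_or_nonempty B with hBe | ⟨⟨i₀⟩⟩
  · have : IsEmpty G := ⟨fun j => (hgood j).elim fun i _ => hBe.elim i⟩
    exact ⟨1, one_pos, by simp, fun i => hBe.elim i⟩
  set n := Fintype.card B + Fintype.card G
  have hn1 : 1 ≤ n := by
    have : 0 < Fintype.card B := Fintype.card_pos_iff.2 ⟨i₀⟩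
    omega
  have hR1 : 1 ≤ R := (hm i₀).trans_le (hmR i₀)
  have hU1 : 1 ≤ Umax := by
    obtain ⟨j, hj⟩ := hbuyer i₀
    exact hj.trans_le (hU i₀ j)
  have hs := hopt.1.2
  let γ : B → ℝ := fun i => m i / surplus U c x i
  have hγ : ∀ i, 0 < γ i := fun i => div_pos (by exact_mod_cast hm i) (hs i)
  choose p hp hpγ' using fun j => hopt.exists_price hm (hgood j)
  have hpγ : ∀ i j, 0 < x i j → p j = U i j * γ i := fun i j => hpγ' j i
  have hG : ∀ j, ∑ i, x i j = 1 := fun j => hopt.sum_eq_one hm (hgood j)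
  have hx0 := hopt.1.1.1
  have hB : ∀ i, ∑ j, p j * x i j = m i + γ i * c i := by
    intro i
    have h1 : ∀ j, p j * x i j = γ i * (U i j * x i j) := by
      intro j
      rcases (hx0 i j).eq_or_lt with h | h
      · simp [← h]
      · rw [hpγ i j h]
        ring
    have h2 : γ i * surplus U c x i = m i := div_mul_cancel₀ _ (hs i).ne'
    simp only [h1, ← mul_sum]
    rw [← h2, surplus]
    ring
  set K := bipGraph fun a b => 0 < x a b
  let comps : Finset K.ConnectedComponent := univ.image fun i => K.connectedComponentMk (Sum.inl i)
  let M : K.ConnectedComponent → ℕ := fun C =>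
    ∑ a with K.connectedComponentMk (Sum.inl a) = C, m a
  let D : ℕ := ∏ e : B × G with 0 < x e.1 e.2, U e.1 e.2
  have hDpos : 0 < D := by
    refine prod_pos fun e he => Nat.pos_of_ne_zero fun h0 => ?_
    have := hpγ e.1 e.2 (mem_filter.1 he).2
    rw [h0, Nat.cast_zero, zero_mul] at this
    exact (hp e.2).ne' this
  have hMpos : ∀ C ∈ comps, 0 < M C := by
    intro C hC
    obtain ⟨a, -, rfl⟩ := mem_image.1 hC
    exact sum_pos (fun b _ => hm b) ⟨a, by simp⟩
  have hDle : D ≤ Umax ^ n :=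
    (prod_le_pow_card _ _ _ fun e _ => hU e.1 e.2).trans
      (Nat.pow_le_pow_right hU1 (hopt.card_support_le huniq))
  have hMle : ∀ C ∈ comps, M C ≤ n * R := by
    intro C _
    refine (sum_le_card_nsmul _ _ R fun a _ => hmR a).trans ?_
    rw [smul_eq_mul]
    exact Nat.mul_le_mul_right _ ((card_le_univ _).trans (Nat.le_add_right _ _))
  have hMprod : ∏ C ∈ comps, M C ≤ (n * R) ^ n :=
    (prod_le_pow_card _ _ _ hMle).trans
      (Nat.pow_le_pow_right (Nat.mul_pos hn1 hR1)
        (card_image_le.trans (Nat.le_add_right _ _)))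
  refine ⟨(∏ C ∈ comps, M C) * D, Nat.mul_pos (prod_pos hMpos) hDpos, ?_, fun i j hij => ?_⟩
  · rw [mul_pow _ Umax]
    exact Nat.mul_le_mul hMprod hDle
  obtain ⟨z, hz⟩ := exists_int_component_mul hx0 hp hpγ hG hB
    (hopt.not_reachable_of_unique huniq hγ hp hpγ hij)
    (fun v => K.connectedComponentMk v = K.connectedComponentMk (Sum.inl i)) (by
      have hadj : K.Adj (Sum.inl i) (Sum.inr j) := bipGraph_adj_inl_inr hij
      intro v
      rw [SimpleGraph.ConnectedComponent.eq]
      exact ⟨fun h => hadj.symm.reachable.trans h.symm, fun h => h.symm.trans hadj.symm.reachable⟩)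
  obtain ⟨r, hr⟩ : M (K.connectedComponentMk (Sum.inl i)) ∣ ∏ C ∈ comps, M C :=
    dvd_prod_of_mem _ (mem_image_of_mem _ (mem_univ i))
  have hz0 : 0 ≤ z := by
    have : (0 : ℝ) ≤ z := by rw [← hz]; exact mul_nonneg (by positivity) (hx0 i j)
    exact_mod_cast this
  lift z to ℕ using hz0
  have hS : (((∏ C ∈ comps, M C) * D : ℕ) : ℝ) ≠ 0 :=
    Nat.cast_ne_zero.2 (Nat.mul_pos (prod_pos hMpos) hDpos).ne'
  refine ⟨r * z, ?_⟩
  rw [eq_div_iff hS, hr]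
  change (D : ℝ) * (M (K.connectedComponentMk (Sum.inl i)) : ℝ) * x i j = ((z : ℤ) : ℝ) at hz
  push_cast at hz ⊢
  rw [← hz]
  ring
end

section
/- Consider a linear generalized flow instance with sink t, integer capacities u and demands b, and gain factors γ_{ij} that are ratios of positive integers at most B, on a graph with n nodes. Form the symmetric instance with penalty factors M_t=1 and M_i=B^n+1 for i≠t, and with the demand b_t at t chosen as an integer strictly larger than Σ_{j:jt∈E} γ_{jt}u_{jt} − Σ_{j:tj∈E} ℓ_{tj} (so that e_t<0 for every pseudoflow). Let f be an optimal solution of this symmetric instance. Then: (a) if e_i ≥ 0 for all i∈V−t, f is an optimal solution of the sink formulation; and (b) if e_i < 0 for some i∈V−t, then the sink formulation is infeasible, i.e. no pseudoflow satisfies e_i ≥ 0 for all i∈V−t. -/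
open Finset

variable {V : Type*} [Fintype V] [DecidableEq V]

/-- A pseudoflow: `ℓ ≤ f ≤ u` on every arc. -/
def IsPseudoflow (E : Finset (V × V)) (l u : V × V → ℝ) (f : V × V → ℝ) : Prop :=
  ∀ a ∈ E, l a ≤ f a ∧ f a ≤ u a

/-- The excess `e_i = Σ_{ji∈E} γ_{ji} f_{ji} − Σ_{ij∈E} f_{ij} − b_i`. -/
noncomputable def excess (E : Finset (V × V)) (γ : V × V → ℝ) (b : V → ℝ)
    (f : V × V → ℝ) (i : V) : ℝ :=
  ∑ a ∈ E.filter (fun a => a.2 = i), γ a * f a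
    - ∑ a ∈ E.filter (fun a => a.1 = i), f a - b i

/-- The excess discrepancy `κ_f = Σ_i M_i · max{−e_i, 0}`. -/
noncomputable def kappa (E : Finset (V × V)) (γ : V × V → ℝ) (b : V → ℝ)
    (M : V → ℝ) (f : V × V → ℝ) : ℝ :=
  ∑ i, M i * max (-(excess E γ b f i)) 0

omit [Fintype V] in
theorem excess_convexComb (E : Finset (V × V)) (γ : V × V → ℝ) (b : V → ℝ)
    (f g : V × V → ℝ) {x y : ℝ} (hxy : x + y = 1) (j : V) :
    excess E γ b (fun a => x * f a + y * g a) j = x * excess E γ b f j + y * excess E γ b g j := by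
  have hy : y = 1 - x := by linarith
  subst hy
  simp only [excess, mul_add, sum_add_distrib, mul_left_comm _ x, mul_left_comm _ (1 - x),
    ← mul_sum]
  ring

omit [Fintype V] [DecidableEq V] in
theorem IsPseudoflow.convexComb {E : Finset (V × V)} {l u f g : V × V → ℝ}
    (hf : IsPseudoflow E l u f) (hg : IsPseudoflow E l u g) {x y : ℝ} (hx : 0 ≤ x) (hy : 0 ≤ y)
    (hxy : x + y = 1) : IsPseudoflow E l u (fun a => x * f a + y * g a) := fun a ha =>
  convex_Icc (l a) (u a) (hf a ha) (hg a ha) hx hy hxy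

omit [Fintype V] in
theorem excess_update (E : Finset (V × V)) (γ : V × V → ℝ) (b : V → ℝ) (f : V × V → ℝ)
    {a : V × V} (ha : a ∈ E) (x : ℝ) (j : V) :
    excess E γ b (Function.update f a x) j = excess E γ b f j
      + (if j = a.2 then γ a * (x - f a) else 0) - (if j = a.1 then x - f a else 0) := by
  have h : Function.update f a x = fun c => f c + if c = a then x - f a else 0 := by
    ext c
    by_cases hc : c = a
    · subst hc; simp
    · simp [hc]
  simp only [h, excess, mul_add, sum_add_distrib, mul_ite, mul_zero, sum_ite_eq', mem_filter, ha,
    true_and, eq_comm (a := j)]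
  ring

omit [Fintype V] in
theorem IsPseudoflow.update {E : Finset (V × V)} {l u f : V × V → ℝ}
    (hf : IsPseudoflow E l u f) {a : V × V} {x : ℝ} (hl : l a ≤ x) (hu : x ≤ u a) :
    IsPseudoflow E l u (Function.update f a x) := by
  intro c hc
  by_cases h : c = a
  · subst h; simp [hl, hu]
  · simpa [h] using hf c hc

/-- From `f`, some positive amount of flow can be sent from `v` to `w` with gain at least `c`,
without decreasing the excess of any other node. -/
def CanSend (E : Finset (V × V)) (l u γ : V × V → ℝ) (b : V → ℝ) (f : V × V → ℝ)
    (c : ℝ) (v w : V) : Prop :=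
  ∃ ε > 0, ∃ h, IsPseudoflow E l u h ∧ ∀ j, excess E γ b f j - (if j = v then ε else 0)
    + (if j = w then ε * c else 0) ≤ excess E γ b h j

section CanSend

variable {E : Finset (V × V)} {l u γ : V × V → ℝ} {b : V → ℝ} {f : V × V → ℝ}

omit [Fintype V] in
theorem CanSend.refl (hf : IsPseudoflow E l u f) (v : V) : CanSend E l u γ b f 1 v v :=
  ⟨1, one_pos, f, hf, fun j => by split_ifs <;> simp⟩

omit [Fintype V] in
theorem CanSend.mono {c d : ℝ} {v w : V} (h : CanSend E l u γ b f c v w) (hd : d ≤ c) :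
    CanSend E l u γ b f d v w := by
  obtain ⟨ε, hε, p, hp, hj⟩ := h
  refine ⟨ε, hε, p, hp, fun j => le_trans ?_ (hj j)⟩
  have := mul_le_mul_of_nonneg_left hd hε.le
  split_ifs <;> linarith

omit [Fintype V] in
theorem CanSend.trans {c d : ℝ} {v w x : V} (hc : 0 < c) (h : CanSend E l u γ b f c v w)
    (h' : CanSend E l u γ b f d w x) : CanSend E l u γ b f (c * d) v x := by
  obtain ⟨s, hs, p, hp, hpj⟩ := h
  obtain ⟨ε, hε, q, hq, hqj⟩ := h'
  have hD : 0 < ε + s * c := by positivity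
  have hxy : ε / (ε + s * c) + s * c / (ε + s * c) = 1 := by field_simp
  refine ⟨ε / (ε + s * c) * s, by positivity, _,
    hp.convexComb hq (by positivity) (by positivity) hxy, fun j => ?_⟩
  rw [excess_convexComb _ _ _ _ _ hxy]
  have h1 := mul_le_mul_of_nonneg_left (hpj j) (show 0 ≤ ε / (ε + s * c) by positivity)
  have h2 := mul_le_mul_of_nonneg_left (hqj j) (show 0 ≤ s * c / (ε + s * c) by positivity)
  refine le_trans (le_of_eq ?_) (add_le_add h1 h2)
  split_ifs <;> field_simp <;> ring

omit [Fintype V] in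
theorem canSend_forward (hf : IsPseudoflow E l u f) {a : V × V} (ha : a ∈ E) (h : f a < u a) :
    CanSend E l u γ b f (γ a) a.1 a.2 := by
  refine ⟨u a - f a, sub_pos.2 h, _,
    hf.update ((hf a ha).1.trans h.le) le_rfl, fun j => le_of_eq ?_⟩
  rw [excess_update _ _ _ _ ha]
  split_ifs <;> ring

omit [Fintype V] in
theorem canSend_backward (hf : IsPseudoflow E l u f) {a : V × V} (ha : a ∈ E) (hγ : 0 < γ a)
    (h : l a < f a) : CanSend E l u γ b f (γ a)⁻¹ a.2 a.1 := by
  refine ⟨γ a * (f a - l a), mul_pos hγ (sub_pos.2 h), _,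
    hf.update le_rfl (h.le.trans (hf a ha).2), fun j => le_of_eq ?_⟩
  rw [excess_update _ _ _ _ ha]
  have := mul_inv_cancel₀ hγ.ne'
  split_ifs <;> grind

end CanSend

/-- The nodes that can reach `i` in the residual graph of `f` form a set that no residual arc
enters, and each of them can send flow to `i` with gain at least `B ^ (-|V|)`. -/
theorem exists_closed_canSend {E : Finset (V × V)} {l u γ : V × V → ℝ} (b : V → ℝ)
    {f : V × V → ℝ} {B : ℝ} (hB : 1 ≤ B) (hγ : ∀ a ∈ E, B⁻¹ ≤ γ a ∧ γ a ≤ B)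
    (hf : IsPseudoflow E l u f) (i : V) :
    ∃ S : Finset V, i ∈ S ∧ (∀ v ∈ S, CanSend E l u γ b f (B ^ Fintype.card V)⁻¹ v i) ∧
      (∀ a ∈ E, a.2 ∈ S → f a < u a → a.1 ∈ S) ∧
      (∀ a ∈ E, a.1 ∈ S → l a < f a → a.2 ∈ S) := by
  classical
  have hB0 : 0 < B := by linarith
  have anti {m n : ℕ} (h : m ≤ n) : (B ^ n)⁻¹ ≤ (B ^ m)⁻¹ :=
    inv_anti₀ (by positivity) (pow_le_pow_right₀ hB h)
  let F : Finset (Finset V) :=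
    univ.filter fun S => i ∈ S ∧ ∀ v ∈ S, CanSend E l u γ b f (B ^ #S)⁻¹ v i
  have hF : F.Nonempty := ⟨{i}, by
    simpa [F] using (CanSend.refl hf i).mono (inv_le_one_of_one_le₀ hB)⟩
  obtain ⟨S, hSF, hmax⟩ := F.exists_max_image card hF
  obtain ⟨hiS, hS⟩ : i ∈ S ∧ ∀ v ∈ S, CanSend E l u γ b f (B ^ #S)⁻¹ v i := by
    simpa [F] using hSF
  have closed : ∀ v w, v ∈ S → CanSend E l u γ b f B⁻¹ w v → w ∈ S := by
    intro v w hv hwv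
    by_contra hw
    have hcard : #(insert w S) = #S + 1 := card_insert_of_notMem hw
    have hmem : insert w S ∈ F := by
      simp only [F, mem_filter, mem_univ, true_and, mem_insert, hiS, or_true, hcard,
        forall_eq_or_imp]
      refine ⟨?_, fun x hx => (hS x hx).mono (anti (Nat.le_succ _))⟩
      rw [pow_succ', mul_inv]
      exact hwv.trans (by positivity) (hS v hv)
    have := hmax _ hmem
    omega
  refine ⟨S, hiS, fun v hv => (hS v hv).mono (anti (card_le_univ S)), ?_, ?_⟩
  · exact fun a ha h2 hu => closed _ _ h2 ((canSend_forward hf ha hu).mono (hγ a ha).1)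
  · intro a ha h1 hl
    have hpos : 0 < γ a := lt_of_lt_of_le (by positivity) (hγ a ha).1
    exact closed _ _ h1 ((canSend_backward hf ha hpos hl).mono (inv_anti₀ hpos (hγ a ha).2))

/-- If flow can be sent from `t` to a deficient node `i` with gain `c`, where `M i * c > M t`,
then the excess discrepancy of `f` can be decreased. -/
theorem CanSend.exists_kappa_lt {E : Finset (V × V)} {l u γ : V × V → ℝ} {b : V → ℝ}
    {f : V × V → ℝ} {c : ℝ} {t i : V} (h : CanSend E l u γ b f c t i)
    (hf : IsPseudoflow E l u f) {M : V → ℝ} (hM : ∀ j, 0 ≤ M j) (hc : 0 < c)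
    (hMc : M t < M i * c) (hit : i ≠ t) (hi : excess E γ b f i < 0) :
    ∃ g, IsPseudoflow E l u g ∧ kappa E γ b M g < kappa E γ b M f := by
  obtain ⟨ε, hε, p, hp, hpj⟩ := h
  set e := excess E γ b f with he
  have hd : 0 < ε * c - e i := by nlinarith [mul_pos hε hc]
  -- scaled so that `i` does not end up with positive excess
  obtain ⟨x, hx0, hx1, hxi⟩ : ∃ x : ℝ, 0 < x ∧ x ≤ 1 ∧ x * (ε * c) ≤ -e i := by
    have := mul_pos hε hc
    refine ⟨-e i / (ε * c - e i), div_pos (by linarith) hd, ?_, ?_⟩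
    · rw [div_le_one hd]; linarith
    · rw [div_mul_eq_mul_div, div_le_iff₀ hd]; nlinarith
  have hxy : x + (1 - x) = 1 := by ring
  refine ⟨_, hp.convexComb hf hx0.le (by linarith) hxy, ?_⟩
  have key : ∀ j, M j * max (-excess E γ b (fun a => x * p a + (1 - x) * f a) j) 0 ≤
      M j * max (-e j) 0 + ((if j = t then M t * (x * ε) else 0)
        - (if j = i then M i * (x * (ε * c)) else 0)) := by
    intro j
    rw [excess_convexComb _ _ _ _ _ hxy, ← he]
    have h1 := mul_le_mul_of_nonneg_left (hpj j) hx0.le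
    have hxε : 0 < x * ε := by positivity
    by_cases hjt : j = t
    · subst hjt
      simp only [hit.symm, if_true, if_false] at h1 ⊢
      rw [sub_zero, ← mul_add]
      refine mul_le_mul_of_nonneg_left (max_le ?_ ?_) (hM j)
      · linarith [le_max_left (-e j) 0]
      · linarith [le_max_right (-e j) 0]
    · by_cases hji : j = i
      · subst hji
        simp only [hit, if_true, if_false] at h1 ⊢
        rw [zero_sub, ← sub_eq_add_neg, ← mul_sub]
        refine mul_le_mul_of_nonneg_left (max_le ?_ ?_) (hM j)
        · linarith [le_max_left (-e j) 0]
        · linarith [le_max_left (-e j) 0]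
      · simp only [hjt, hji, if_false] at h1 ⊢
        rw [sub_zero, add_zero]
        refine mul_le_mul_of_nonneg_left (max_le_max_right _ ?_) (hM j)
        linarith
  have hsum := sum_le_sum fun j (_ : j ∈ univ) => key j
  simp only [sum_add_distrib, sum_sub_distrib, sum_ite_eq', mem_univ, if_true] at hsum
  have : M t * (x * ε) < M i * (x * (ε * c)) := by
    have := mul_lt_mul_of_pos_right hMc (mul_pos hx0 hε)
    linarith
  unfold kappa
  linarith

omit [Fintype V] in
/-- If no residual arc of `f` enters `S`, then replacing `f` by `g` inside `S` yields excesses at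
least those of `g` on `S`, and leaves the other excesses unchanged. -/
theorem exists_pseudoflow_glue {E : Finset (V × V)} {l u γ : V × V → ℝ} (b : V → ℝ)
    {f g : V × V → ℝ} (hγ : ∀ a ∈ E, 0 ≤ γ a) (hf : IsPseudoflow E l u f)
    (hg : IsPseudoflow E l u g) {S : Finset V}
    (hin : ∀ a ∈ E, a.2 ∈ S → f a < u a → a.1 ∈ S)
    (hout : ∀ a ∈ E, a.1 ∈ S → l a < f a → a.2 ∈ S) :
    ∃ h, IsPseudoflow E l u h ∧ (∀ v ∈ S, excess E γ b g v ≤ excess E γ b h v) ∧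
      ∀ v ∉ S, excess E γ b h v = excess E γ b f v := by
  refine ⟨fun a => if a.1 ∈ S ∧ a.2 ∈ S then g a else f a, ?_, ?_, ?_⟩
  · intro a ha
    dsimp only
    split_ifs
    exacts [hg a ha, hf a ha]
  · intro v hv
    refine sub_le_sub_right (sub_le_sub (sum_le_sum ?_) (sum_le_sum ?_)) _
    · intro a ha
      obtain ⟨haE, rfl⟩ := mem_filter.1 ha
      refine mul_le_mul_of_nonneg_left ?_ (hγ a haE)
      by_cases h1 : a.1 ∈ S
      · simp [h1, hv]
      · simpa [h1] using (hg a haE).2.trans (not_lt.1 fun h => h1 (hin a haE hv h))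
    · intro a ha
      obtain ⟨haE, rfl⟩ := mem_filter.1 ha
      by_cases h2 : a.2 ∈ S
      · simp [h2, hv]
      · simpa [h2] using (not_lt.1 fun h => h2 (hout a haE hv h)).trans (hg a haE).1
  · intro v hv
    unfold excess
    congr 2 <;> refine sum_congr rfl fun a ha => ?_ <;> obtain ⟨-, rfl⟩ := mem_filter.1 ha <;>
      simp [hv]

theorem kappa_lt_kappa {E : Finset (V × V)} {γ : V × V → ℝ} {b : V → ℝ} {M : V → ℝ}
    {f h : V × V → ℝ} (hM : ∀ j, 0 < M j)
    (hle : ∀ v, excess E γ b f v ≤ excess E γ b h v ∨ 0 ≤ excess E γ b h v) {i : V}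
    (hi : excess E γ b f i < 0) (hi' : 0 ≤ excess E γ b h i) :
    kappa E γ b M h < kappa E γ b M f := by
  refine sum_lt_sum (fun v _ => mul_le_mul_of_nonneg_left ?_ (hM v).le) ⟨i, mem_univ i, ?_⟩
  · rcases hle v with h1 | h1
    · exact max_le_max_right _ (neg_le_neg h1)
    · rw [max_eq_right (neg_nonpos.2 h1)]; exact le_max_right _ _
  · refine mul_lt_mul_of_pos_left ?_ (hM i)
    rw [max_eq_right (neg_nonpos.2 hi')]
    exact lt_max_of_lt_left (neg_pos.2 hi)

omit [Fintype V] in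
theorem excess_le {E : Finset (V × V)} {l u γ : V × V → ℝ} (b : V → ℝ) {g : V × V → ℝ}
    (hγ : ∀ a ∈ E, 0 ≤ γ a) (hg : IsPseudoflow E l u g) (t : V) :
    excess E γ b g t ≤ ∑ a ∈ E.filter (fun a => a.2 = t), γ a * u a
        - ∑ a ∈ E.filter (fun a => a.1 = t), l a - b t := by
  refine sub_le_sub_right (sub_le_sub (sum_le_sum fun a ha => ?_) (sum_le_sum fun a ha => ?_)) _
  · have haE := (mem_filter.1 ha).1
    exact mul_le_mul_of_nonneg_left (hg a haE).2 (hγ a haE)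
  · exact (hg a (mem_filter.1 ha).1).1

theorem kappa_of_nonneg_off {E : Finset (V × V)} {γ : V × V → ℝ} {b : V → ℝ} {M : V → ℝ}
    {g : V × V → ℝ} {t : V} (h : ∀ i, i ≠ t → 0 ≤ excess E γ b g i)
    (ht : excess E γ b g t ≤ 0) : kappa E γ b M g = M t * -excess E γ b g t := by
  unfold kappa
  rw [sum_eq_single t, max_eq_left (neg_nonneg.2 ht)]
  · intro i _ hi
    rw [max_eq_right (neg_nonpos.2 (h i hi)), mul_zero]
  · simp

/-- Consider a linear generalized flow instance with sink `t`, integer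
capacities and demands, gain factors that are ratios of positive integers at most `B`, on
a graph with `n` nodes. Form the symmetric instance with `M_t = 1`, `M_i = B^n + 1` for
`i ≠ t`, and with the (integer) demand `b_t` strictly larger than
`Σ_{jt∈E} γ_{jt} u_{jt} − Σ_{tj∈E} ℓ_{tj}` (so `e_t < 0` for every pseudoflow). If `f` is
an optimal solution of this symmetric instance, then:
(a) if `e_i ≥ 0` for all `i ≠ t`, `f` is an optimal solution of the sink formulation; and
(b) if `e_i < 0` for some `i ≠ t`, the sink formulation is infeasible. -/
theorem sink_from_symmetric_linear
    (E : Finset (V × V)) (l u γ : V × V → ℝ) (b : V → ℝ) (t : V) (B : ℕ)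
    (hlu : ∀ a ∈ E, l a ≤ u a)
    (hl_int : ∀ a ∈ E, ∃ z : ℤ, l a = z)
    (hu_int : ∀ a ∈ E, ∃ z : ℤ, u a = z)
    (hb_int : ∀ i, ∃ z : ℤ, b i = z)
    (hγ : ∀ a ∈ E, ∃ p q : ℕ, 0 < p ∧ 0 < q ∧ p ≤ B ∧ q ≤ B ∧ γ a = (p : ℝ) / q)
    (hbt : ∑ a ∈ E.filter (fun a => a.2 = t), γ a * u a
        - ∑ a ∈ E.filter (fun a => a.1 = t), l a < b t)
    (f : V × V → ℝ) (hf : IsPseudoflow E l u f)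
    (hopt : ∀ g, IsPseudoflow E l u g →
      kappa E γ b (fun i => if i = t then 1 else (B : ℝ) ^ Fintype.card V + 1) f ≤
        kappa E γ b (fun i => if i = t then 1 else (B : ℝ) ^ Fintype.card V + 1) g) :
    ((∀ i, i ≠ t → 0 ≤ excess E γ b f i) →
      ∀ g, IsPseudoflow E l u g → (∀ i, i ≠ t → 0 ≤ excess E γ b g i) →
        excess E γ b g t ≤ excess E γ b f t) ∧
    ((∃ i, i ≠ t ∧ excess E γ b f i < 0) →
      ¬ ∃ g, IsPseudoflow E l u g ∧ ∀ i, i ≠ t → 0 ≤ excess E γ b g i) := by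
  have hpos : ∀ a ∈ E, 0 < γ a := by
    intro a ha
    obtain ⟨p, q, hp, hq, -, -, h⟩ := hγ a ha
    rw [h]
    positivity
  have hγ0 : ∀ a ∈ E, 0 ≤ γ a := fun a ha => (hpos a ha).le
  set M : V → ℝ := fun i => if i = t then 1 else (B : ℝ) ^ Fintype.card V + 1 with hMdef
  have hM : ∀ j, 0 < M j := by
    intro j
    simp only [hMdef]
    split_ifs <;> positivity
  have hMt : M t = 1 := if_pos rfl
  refine ⟨fun hfe g hg hge => ?_, ?_⟩
  · have hneg : ∀ g, IsPseudoflow E l u g → excess E γ b g t ≤ 0 := fun g hg => by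
      linarith [excess_le b hγ0 hg t]
    have := hopt g hg
    rw [kappa_of_nonneg_off hfe (hneg f hf), kappa_of_nonneg_off hge (hneg g hg), hMt] at this
    linarith
  · rintro ⟨i, hit, hi⟩ ⟨g, hg, hge⟩
    rcases E.eq_empty_or_nonempty with rfl | ⟨a₀, ha₀⟩
    · have := hge i hit
      simp only [excess, filter_empty, sum_empty] at hi this
      linarith
    have hB : (1 : ℝ) ≤ B := by
      obtain ⟨p, -, hp, -, hpB, -⟩ := hγ a₀ ha₀
      exact_mod_cast hp.trans_le hpB
    have hγB : ∀ a ∈ E, (B : ℝ)⁻¹ ≤ γ a ∧ γ a ≤ B := by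
      intro a ha
      obtain ⟨p, q, hp, hq, hpB, hqB, h⟩ := hγ a ha
      have hp1 : (1 : ℝ) ≤ p := by exact_mod_cast hp
      have hq1 : (1 : ℝ) ≤ q := by exact_mod_cast hq
      have hpB' : (p : ℝ) ≤ B := by exact_mod_cast hpB
      have hqB' : (q : ℝ) ≤ B := by exact_mod_cast hqB
      rw [h, ← one_div]
      exact ⟨div_le_div₀ (by linarith) hp1 (by linarith) hqB',
        (div_le_self (by linarith) hq1).trans hpB'⟩
    obtain ⟨S, hiS, hS, hin, hout⟩ := exists_closed_canSend b hB hγB hf i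
    by_cases htS : t ∈ S
    · have hBn : (0 : ℝ) < (B : ℝ) ^ Fintype.card V := by positivity
      have hMi : M t < M i * ((B : ℝ) ^ Fintype.card V)⁻¹ := by
        rw [hMt, show M i = (B : ℝ) ^ Fintype.card V + 1 from if_neg hit, ← div_eq_mul_inv,
          lt_div_iff₀ hBn]
        linarith
      obtain ⟨p, hp, hlt⟩ := (hS t htS).exists_kappa_lt hf (fun j => (hM j).le)
        (inv_pos.2 hBn) hMi hit hi
      exact (hopt p hp).not_gt hlt
    · obtain ⟨h, hh, hhS, hhS'⟩ := exists_pseudoflow_glue b hγ0 hf hg hin hout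
      have hnn : ∀ v ∈ S, 0 ≤ excess E γ b h v := fun v hv =>
        (hge v (ne_of_mem_of_not_mem hv htS)).trans (hhS v hv)
      refine (hopt h hh).not_gt (kappa_lt_kappa hM (fun v => ?_) hi (hnn i hiS))
      by_cases hv : v ∈ S
      · exact Or.inr (hnn v hv)
      · exact Or.inl (hhS' v hv).ge
end
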